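/- There exists some 0 < ε₁ < 1 such that for any 0 < ε₂ < 1 and s ≥ 20, there exists d₀ = d₀(ε₁,ε₂,s) such that the following holds for each n ≥ d ≥ d₀ with d ≥ log^s n. Suppose G is an n-vertex bipartite (ε₁, ε₂·d)-expander with minimum degree δ(G) ≥ d. Let D = d/log^{10} n, let U ⊆ V(G) with |U| ≤ D/(2 log³ n), and let m = (800/ε₁)·log³ n. Suppose F₁, F₂ ⊆ G − U are vertex disjoint subgraphs such that F_i is a (D,m)-expansion of v_i for i ∈ {1,2}. Let ℓ be an integer with log⁷ n ≤ ℓ ≤ n/log^{10} n and ℓ ≡ π(v₁,v₂,G) (mod 2). Then there is a v₁,v₂-path of length ℓ in G − U. -/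

import Mathlib

open Real

namespace Balanced

variable {V : Type*}

/-- The external neighbourhood of a vertex set `X` in `G`. -/
def extNbr (G : SimpleGraph V) (X : Set V) : Set V := {v | v ∉ X ∧ ∃ u ∈ X, G.Adj u v}

/-- The Komlós–Szemerédi expansion function `ε(x, ε₁, k)`. -/
noncomputable def epsFn (ε₁ k x : ℝ) : ℝ :=
  if x < k / 5 then 0 else ε₁ / (Real.log (15 * x / k)) ^ 2

/-- `G` is an `(ε₁, k)`-expander. -/
def IsExpander (G : SimpleGraph V) (ε₁ k : ℝ) : Prop :=
  ∀ X : Set V, k / 2 ≤ (X.ncard : ℝ) → (X.ncard : ℝ) ≤ (Nat.card V : ℝ) / 2 →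
    epsFn ε₁ k (X.ncard : ℝ) * (X.ncard : ℝ) ≤ ((extNbr G X).ncard : ℝ)

/-- `G` is bipartite. -/
def IsBip (G : SimpleGraph V) : Prop := ∃ f : V → Bool, ∀ u v, G.Adj u v → f u ≠ f v

/-- The average degree `2|E(G)|/|V(G)|` of `G`. -/
noncomputable def avgDeg (G : SimpleGraph V) : ℝ :=
  2 * (Nat.card G.edgeSet : ℝ) / (Nat.card V : ℝ)

/-- The minimum degree of `G` is at least `d`. -/
def MinDegGE (G : SimpleGraph V) (d : ℝ) : Prop :=
  ∀ v : V, d ≤ ((G.neighborSet v).ncard : ℝ)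

/-- The support of a walk, as a set of vertices. -/
def suppSet {G : SimpleGraph V} {a b : V} (w : G.Walk a b) : Set V := {x | x ∈ w.support}

/-- `G` contains an `ℓ`-balanced subdivision `TK_k^(ℓ)` of the complete graph `K_k`:
there are `k` core vertices joined pairwise by internally vertex-disjoint paths of
length exactly `ℓ`, whose internal vertices avoid all core vertices. -/
def ContainsBalSub (G : SimpleGraph V) (k ℓ : ℕ) : Prop :=
  ∃ c : Fin k → V, Function.Injective c ∧
    ∃ P : ∀ i j : Fin k, i < j → G.Walk (c i) (c j),
      (∀ i j (h : i < j), (P i j h).IsPath ∧ (P i j h).length = ℓ) ∧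
      (∀ i j (h : i < j) (q : Fin k), c q ∈ (P i j h).support → q = i ∨ q = j) ∧
      (∀ i j (h : i < j) i' j' (h' : i' < j'), (i, j) ≠ (i', j') →
        ∀ x, x ∈ (P i j h).support → x ∈ (P i' j' h').support →
          (x = c i ∨ x = c j) ∧ (x = c i' ∨ x = c j'))

/-- The subgraph `F` of `G` is a `(D, m)`-expansion of the vertex `v`:
`|V(F)| = D` and every vertex of `F` is at distance at most `m` from `v` in `F`. -/
def IsExpansion (G : SimpleGraph V) (F : G.Subgraph) (v : V) (D m : ℝ) : Prop :=
  ∃ hv : v ∈ F.verts, ((F.verts.ncard : ℝ) = D ∧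
    ∀ u, ∀ hu : u ∈ F.verts, ∃ w : F.coe.Walk ⟨v, hv⟩ ⟨u, hu⟩, (w.length : ℝ) ≤ m)

/-- `G` contains a `(D, m, k)`-adjuster. -/
def HasAdjuster (G : SimpleGraph V) (D m : ℝ) (k : ℕ) : Prop :=
  ∃ (v₁ v₂ : V) (F₁ F₂ : G.Subgraph) (A : Set V),
    Disjoint A F₁.verts ∧ Disjoint A F₂.verts ∧ Disjoint F₁.verts F₂.verts ∧
    IsExpansion G F₁ v₁ D m ∧ IsExpansion G F₂ v₂ D m ∧
    (A.ncard : ℝ) ≤ 10 * m * (k : ℝ) ∧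
    ∃ ℓ : ℕ, ∀ i : ℕ, i ≤ k → ∃ w : G.Walk v₁ v₂, w.IsPath ∧
      w.length = ℓ + 2 * i ∧ ∀ x ∈ w.support, x ∈ A ∪ {v₁, v₂}

open Classical in
/-- `π(u, v, G)` for a connected bipartite graph `G`: `0` if `u = v`, `1` if `u, v`
lie in different classes of the bipartition (equivalently, are joined by an odd walk),
and `2` otherwise. -/
noncomputable def piVal (G : SimpleGraph V) (u v : V) : ℕ :=
  if u = v then 0 else if ∃ w : G.Walk u v, Odd w.length then 1 else 2

/-- The ball of radius `r` around `v` in the subgraph of `G` induced on `S`,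
viewed as a subset of `V`. -/
def ballIn (G : SimpleGraph V) (S : Set V) (v : V) (r : ℕ) : Set V :=
  {u | ∃ w : G.Walk v u, w.length ≤ r ∧ ∀ x ∈ w.support, x ∈ S}

/-- The ball of radius `r` around the set `Y` in the subgraph of `G` induced on `S`. -/
def ballSetIn (G : SimpleGraph V) (S : Set V) (Y : Set V) (r : ℕ) : Set V :=
  {u | ∃ y ∈ Y, ∃ w : G.Walk y u, w.length ≤ r ∧ ∀ x ∈ w.support, x ∈ S}

/-- `P 0, …, P (q-1)` are consecutive shortest paths from `v` in the vertex set `W`: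
each `P i` is a shortest path between its endpoints in the graph induced on
`(W \ ⋃_{j<i} V(P j)) ∪ {v}`. -/
def ConsecSP (G : SimpleGraph V) (v : V) (W : Set V) {q : ℕ}
    (P : Fin q → Σ u : V, G.Walk v u) : Prop :=
  ∀ i : Fin q,
    (∀ x ∈ suppSet (P i).2,
      x ∈ (W \ ⋃ (j : Fin q) (_ : j < i), suppSet (P j).2) ∪ {v}) ∧
    ((P i).2).IsPath ∧
    ∀ w' : G.Walk v (P i).1,
      (∀ x ∈ suppSet w',
        x ∈ (W \ ⋃ (j : Fin q) (_ : j < i), suppSet (P j).2) ∪ {v}) →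
      ((P i).2).length ≤ w'.length

/-- `v` is an end vertex of the path `p`. -/
def IsEnd (G : SimpleGraph V) (v : V) (p : Σ a b : V, G.Walk a b) : Prop :=
  v = p.1 ∨ v = p.2.1

/-- `t` is the subpath `p(v, r)` of `p` of length `r` having `v` as an end vertex. -/
def IsTrunc (G : SimpleGraph V) (r : ℕ) (p : Σ a b : V, G.Walk a b) (v : V)
    (t : Σ u : V, G.Walk v u) : Prop :=
  t.2.length = r ∧ ∃ (c : V) (w' : G.Walk t.1 c),
    (⟨v, c, t.2.append w'⟩ : Σ a b : V, G.Walk a b) = p ∨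
    (⟨v, c, t.2.append w'⟩ : Σ a b : V, G.Walk a b) = ⟨p.2.1, p.1, p.2.2.reverse⟩

section Walks

variable {G : SimpleGraph V}

/-- There is a walk of length at most `L` from `u` to `v` inside the vertex set `S`. -/
def WalkIn (G : SimpleGraph V) (S : Finset V) (u v : V) (L : ℕ) : Prop :=
  ∃ w : G.Walk u v, w.length ≤ L ∧ ∀ x ∈ w.support, x ∈ S

/-- There is a path of length exactly `L` from `u` to `v` inside the vertex set `S`. -/
def PathIn (G : SimpleGraph V) (S : Finset V) (u v : V) (L : ℕ) : Prop :=
  ∃ w : G.Walk u v, w.IsPath ∧ w.length = L ∧ ∀ x ∈ w.support, x ∈ S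

theorem WalkIn.refl {S : Finset V} {u : V} (hu : u ∈ S) (L : ℕ) : WalkIn G S u u L :=
  ⟨.nil, by simp, by simpa using hu⟩

theorem WalkIn.symm {S : Finset V} {u v : V} {L : ℕ} (h : WalkIn G S u v L) :
    WalkIn G S v u L := by
  obtain ⟨w, hl, hs⟩ := h
  exact ⟨w.reverse, by simpa using hl, by simpa using hs⟩

theorem WalkIn.mono {S T : Finset V} {u v : V} {L K : ℕ} (h : WalkIn G S u v L)
    (hST : S ⊆ T) (hLK : L ≤ K) : WalkIn G T u v K := by
  obtain ⟨w, hl, hs⟩ := h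
  exact ⟨w, hl.trans hLK, fun x hx => hST (hs x hx)⟩

theorem WalkIn.trans {S : Finset V} {u v x : V} {L K : ℕ} (h : WalkIn G S u v L)
    (h' : WalkIn G S v x K) : WalkIn G S u x (L + K) := by
  obtain ⟨w, hl, hs⟩ := h
  obtain ⟨w', hl', hs'⟩ := h'
  refine ⟨w.append w', by rw [SimpleGraph.Walk.length_append]; omega, fun y hy => ?_⟩
  rw [SimpleGraph.Walk.mem_support_append_iff] at hy
  exact hy.elim (hs y) (hs' y)

theorem WalkIn.snoc {S T : Finset V} {u v x : V} {L : ℕ} (h : WalkIn G S u v L)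
    (hST : S ⊆ T) (hadj : G.Adj v x) (hx : x ∈ T) : WalkIn G T u x (L + 1) := by
  obtain ⟨w, hl, hs⟩ := h
  refine ⟨w.concat hadj, by rw [SimpleGraph.Walk.length_concat]; omega, fun y hy => ?_⟩
  rw [SimpleGraph.Walk.support_concat, List.mem_append, List.mem_singleton] at hy
  rcases hy with hy | rfl
  · exact hST (hs y hy)
  · exact hx

theorem WalkIn.right_mem {S : Finset V} {u v : V} {L : ℕ} (h : WalkIn G S u v L) : v ∈ S := by
  obtain ⟨w, -, hs⟩ := h
  exact hs v w.end_mem_support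

theorem WalkIn.exists_pathIn {S : Finset V} {u v : V} {L : ℕ} (h : WalkIn G S u v L) :
    ∃ K ≤ L, PathIn G S u v K := by
  classical
  obtain ⟨w, hl, hs⟩ := h
  exact ⟨_, (w.length_bypass_le_length).trans hl, w.bypass, w.bypass_isPath, rfl,
    fun x hx => hs x (w.support_bypass_subset_support hx)⟩

theorem PathIn.walkIn {S : Finset V} {u v : V} {L : ℕ} (h : PathIn G S u v L) :
    WalkIn G S u v L := by
  obtain ⟨w, -, hl, hs⟩ := h
  exact ⟨w, hl.le, hs⟩

theorem PathIn.symm {S : Finset V} {u v : V} {L : ℕ} (h : PathIn G S u v L) :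
    PathIn G S v u L := by
  obtain ⟨w, hp, hl, hs⟩ := h
  exact ⟨w.reverse, hp.reverse, by simpa using hl, by simpa using hs⟩

theorem PathIn.mono {S T : Finset V} {u v : V} {L : ℕ} (h : PathIn G S u v L)
    (hST : S ⊆ T) : PathIn G T u v L := by
  obtain ⟨w, hp, hl, hs⟩ := h
  exact ⟨w, hp, hl, fun x hx => hST (hs x hx)⟩

theorem PathIn.refl {S : Finset V} {u : V} (hu : u ∈ S) : PathIn G S u u 0 :=
  ⟨.nil, .nil, rfl, by simpa using hu⟩

theorem PathIn.right_mem {S : Finset V} {u v : V} {L : ℕ} (h : PathIn G S u v L) : v ∈ S := by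
  obtain ⟨w, -, -, hs⟩ := h
  exact hs v w.end_mem_support

theorem PathIn.eq_of_zero {S : Finset V} {u v : V} (h : PathIn G S u v 0) : u = v := by
  obtain ⟨w, -, hl, -⟩ := h
  exact SimpleGraph.Walk.eq_of_length_eq_zero hl

/-- Concatenation of two paths which only meet at the common end vertex. -/
theorem PathIn.append [DecidableEq V] {S T : Finset V} {u v x : V} {L K : ℕ}
    (h : PathIn G S u v L) (h' : PathIn G T v x K) (hST : ∀ y ∈ S, y ∈ T → y = v) :
    PathIn G (S ∪ T) u x (L + K) := by
  obtain ⟨w, hp, hl, hs⟩ := h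
  obtain ⟨w', hp', hl', hs'⟩ := h'
  refine ⟨w.append w', ?_, by rw [SimpleGraph.Walk.length_append]; omega, fun y hy => ?_⟩
  · rw [SimpleGraph.Walk.isPath_def, SimpleGraph.Walk.support_append, List.nodup_append]
    refine ⟨hp.support_nodup, hp'.support_nodup.tail, fun a ha b hb hab => ?_⟩
    subst hab
    have hav : a = v := hST a (hs a ha) (hs' a (List.mem_of_mem_tail hb))
    subst hav
    have := hp'.support_nodup
    rw [← SimpleGraph.Walk.cons_tail_support] at this
    exact (List.nodup_cons.1 this).1 hb
  · rw [SimpleGraph.Walk.mem_support_append_iff] at hy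
    rw [Finset.mem_union]
    exact hy.imp (hs y) (hs' y)

/-- The vertex set of a path is exactly a set of `L + 1` vertices. -/
theorem PathIn.exists_exact [DecidableEq V] {S : Finset V} {u v : V} {L : ℕ}
    (h : PathIn G S u v L) :
    ∃ T ⊆ S, T.card = L + 1 ∧ PathIn G T u v L := by
  obtain ⟨w, hp, hl, hs⟩ := h
  refine ⟨w.support.toFinset, fun x hx => hs x (by simpa using hx), ?_, w, hp, hl, by simp⟩
  rw [List.toFinset_card_of_nodup hp.support_nodup, SimpleGraph.Walk.length_support, hl]

/-- A shortest walk from `A` to `B` inside `S` is a path meeting `A` and `B` only in its ends. -/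
theorem exists_minimal_pathIn [DecidableEq V] {S A B : Finset V} {L : ℕ}
    (h : ∃ u ∈ A, ∃ v ∈ B, WalkIn G S u v L) :
    ∃ u ∈ A, ∃ v ∈ B, ∃ T ⊆ S, ∃ K ≤ L, PathIn G T u v K ∧ T.card = K + 1 ∧
      (∀ x ∈ T, x ∈ A → x = u) ∧ ∀ x ∈ T, x ∈ B → x = v := by
  classical
  have hex : ∃ K, ∃ u ∈ A, ∃ v ∈ B, PathIn G S u v K := by
    obtain ⟨u, hu, v, hv, hw⟩ := h
    obtain ⟨K, -, hK⟩ := hw.exists_pathIn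
    exact ⟨K, u, hu, v, hv, hK⟩
  have hmin := fun K => Nat.find_min' hex (m := K)
  have hKL : Nat.find hex ≤ L := by
    obtain ⟨u, hu, v, hv, hw⟩ := h
    obtain ⟨K, hKL, hK⟩ := hw.exists_pathIn
    exact (hmin K ⟨u, hu, v, hv, hK⟩).trans hKL
  obtain ⟨u, hu, v, hv, w, hp, hl, hs⟩ := Nat.find_spec hex
  refine ⟨u, hu, v, hv, w.support.toFinset, fun x hx => hs x (by simpa using hx), _, hKL,
    ⟨w, hp, hl, by simp⟩, ?_, ?_, ?_⟩
  · rw [List.toFinset_card_of_nodup hp.support_nodup, SimpleGraph.Walk.length_support, hl]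
  · intro x hx hxA
    have hx' : x ∈ w.support := by simpa using hx
    have h1 := hmin _ ⟨x, hxA, v, hv, w.dropUntil x hx', hp.dropUntil hx', rfl,
      fun y hy => hs y (w.support_dropUntil_subset_support hx' hy)⟩
    have h2 := congrArg SimpleGraph.Walk.length (w.take_spec hx')
    rw [SimpleGraph.Walk.length_append] at h2
    exact (SimpleGraph.Walk.eq_of_length_eq_zero (p := w.takeUntil x hx') (by omega)).symm
  · intro x hx hxB
    have hx' : x ∈ w.support := by simpa using hx
    have h1 := hmin _ ⟨u, hu, x, hxB, w.takeUntil x hx', hp.takeUntil hx', rfl,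
      fun y hy => hs y (w.support_takeUntil_subset_support hx' hy)⟩
    have h2 := congrArg SimpleGraph.Walk.length (w.take_spec hx')
    rw [SimpleGraph.Walk.length_append] at h2
    exact SimpleGraph.Walk.eq_of_length_eq_zero (p := w.dropUntil x hx') (by omega)

/-- The set `X` contains `a`, and all its vertices can be reached from `a` by a walk of length
at most `ρ` inside `X`. -/
def IsBlob (G : SimpleGraph V) (X : Finset V) (a : V) (ρ : ℕ) : Prop :=
  a ∈ X ∧ ∀ v ∈ X, WalkIn G X a v ρ

theorem IsBlob.union [DecidableEq V] {X Y : Finset V} {a c : V} {ρ ρ' : ℕ}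
    (hX : IsBlob G X a ρ) (hY : IsBlob G Y c ρ') (hc : c ∈ X) :
    IsBlob G (X ∪ Y) a (ρ + ρ') := by
  refine ⟨Finset.mem_union_left _ hX.1, fun v hv => ?_⟩
  rcases Finset.mem_union.1 hv with hv | hv
  · exact (hX.2 v hv).mono Finset.subset_union_left (by omega)
  · exact ((hX.2 c hc).mono Finset.subset_union_left le_rfl).trans
      ((hY.2 v hv).mono Finset.subset_union_right le_rfl)

theorem IsBlob.reroot {Y : Finset V} {r u : V} {ρ : ℕ} (hY : IsBlob G Y r ρ) (hu : u ∈ Y) :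
    IsBlob G Y u (ρ + ρ) :=
  ⟨hu, fun v hv => (hY.2 u hu).symm.trans (hY.2 v hv)⟩

theorem IsBlob.mono {Y : Finset V} {r : V} {ρ ρ' : ℕ} (hY : IsBlob G Y r ρ) (h : ρ ≤ ρ') :
    IsBlob G Y r ρ' :=
  ⟨hY.1, fun v hv => (hY.2 v hv).mono subset_rfl h⟩

/-- The set of vertices reachable by a short walk inside `S` is a blob. -/
theorem isBlob_filter [DecidableEq V] {S Y : Finset V} {r : V} {ρ : ℕ} (hr : r ∈ S)
    (hY : ∀ v, v ∈ Y ↔ WalkIn G S r v ρ) : IsBlob G Y r ρ := by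
  refine ⟨(hY r).2 (.refl hr ρ), fun v hv => ?_⟩
  obtain ⟨w, hl, hs⟩ := (hY v).1 hv
  refine ⟨w, hl, fun x hx => (hY x).2 ⟨w.takeUntil x hx, ?_, fun y hy => ?_⟩⟩
  · exact (w.length_takeUntil_le_length hx).trans hl
  · exact hs y (w.support_takeUntil_subset_support hx hy)

/-- The vertex set of a path is a blob. -/
theorem PathIn.exists_isBlob [DecidableEq V] {S : Finset V} {u v : V} {L : ℕ}
    (h : PathIn G S u v L) :
    ∃ T ⊆ S, T.card = L + 1 ∧ v ∈ T ∧ IsBlob G T u L := by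
  obtain ⟨w, hp, hl, hs⟩ := h
  refine ⟨w.support.toFinset, fun x hx => hs x (by simpa using hx), ?_, by simp, by simp,
    fun x hx => ?_⟩
  · rw [List.toFinset_card_of_nodup hp.support_nodup, SimpleGraph.Walk.length_support, hl]
  · have hx' : x ∈ w.support := by simpa using hx
    exact ⟨w.takeUntil x hx', (w.length_takeUntil_le_length hx').trans hl.le, fun y hy => by
      simpa using w.support_takeUntil_subset_support hx' hy⟩

end Walks


section Expansion

variable [Fintype V] {G : SimpleGraph V}

open Classical in
/-- The external neighbourhood of a finite vertex set, as a finite set. -/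
noncomputable def nbr (G : SimpleGraph V) (X : Finset V) : Finset V :=
  Finset.univ.filter fun v => v ∉ X ∧ ∃ u ∈ X, G.Adj u v

theorem mem_nbr {X : Finset V} {v : V} : v ∈ nbr G X ↔ v ∉ X ∧ ∃ u ∈ X, G.Adj u v := by
  simp [nbr]

open Classical in
/-- The vertices at distance at most `j` from `A` inside `S`. -/
noncomputable def reach (G : SimpleGraph V) (S A : Finset V) (j : ℕ) : Finset V :=
  Finset.univ.filter fun v => ∃ u ∈ A, WalkIn G S u v j

theorem mem_reach {S A : Finset V} {j : ℕ} {v : V} :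
    v ∈ reach G S A j ↔ ∃ u ∈ A, WalkIn G S u v j := by
  simp [reach]

theorem reach_subset {S A : Finset V} {j : ℕ} : reach G S A j ⊆ S := by
  intro v hv
  obtain ⟨u, -, hw⟩ := mem_reach.1 hv
  exact hw.right_mem

theorem subset_reach {S A : Finset V} (hA : A ⊆ S) (j : ℕ) : A ⊆ reach G S A j :=
  fun v hv => mem_reach.2 ⟨v, hv, .refl (hA hv) j⟩

theorem reach_mono {S A : Finset V} {i j : ℕ} (hij : i ≤ j) : reach G S A i ⊆ reach G S A j := by
  intro v hv
  obtain ⟨u, hu, hw⟩ := mem_reach.1 hv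
  exact mem_reach.2 ⟨u, hu, hw.mono subset_rfl hij⟩

theorem card_reach_succ [DecidableEq V] {S A : Finset V} (j : ℕ) :
    (reach G S A j).card + (nbr G (reach G S A j) ∩ S).card ≤ (reach G S A (j + 1)).card := by
  rw [← Finset.card_union_of_disjoint]
  · refine Finset.card_le_card (Finset.union_subset (reach_mono (by omega)) fun v hv => ?_)
    obtain ⟨hv, hvS⟩ := Finset.mem_inter.1 hv
    obtain ⟨-, u, hu, huv⟩ := mem_nbr.1 hv
    obtain ⟨a, ha, hw⟩ := mem_reach.1 hu
    exact mem_reach.2 ⟨a, ha, hw.snoc subset_rfl huv hvS⟩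
  · rw [Finset.disjoint_left]
    intro v hv hv'
    exact (mem_nbr.1 (Finset.mem_inter.1 hv').1).1 hv

/-- Every vertex set inside `S` of size at least `σ` and at most half of the graph has at least
`η |X|` external neighbours inside `S`. -/
def ExpandsOn [DecidableEq V] (G : SimpleGraph V) (S : Finset V) (η σ : ℝ) : Prop :=
  ∀ X ⊆ S, X.Nonempty → σ ≤ X.card → 2 * X.card ≤ Fintype.card V →
    η * X.card ≤ (nbr G X ∩ S).card

variable [DecidableEq V]

theorem ExpandsOn.lt_two_mul_card_reach {S A : Finset V} {η σ : ℝ} (hS : ExpandsOn G S η σ)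
    (hη : 0 ≤ η) (hA : A ⊆ S) (hne : A.Nonempty) (hσ : σ ≤ A.card) {m : ℕ}
    (hm : (Fintype.card V : ℝ) < (1 + η) ^ m) :
    Fintype.card V < 2 * (reach G S A m).card := by
  by_contra! hcon
  have key : ∀ j ≤ m, (1 + η) ^ j ≤ (reach G S A j).card := by
    intro j
    induction j with
    | zero =>
      intro _
      rw [pow_zero, Nat.one_le_cast, Nat.one_le_iff_ne_zero, Finset.card_ne_zero]
      exact hne.mono (subset_reach hA 0)
    | succ j ih =>
      intro hj
      have h1 := ih (by omega)
      have hsub : A ⊆ reach G S A j := subset_reach hA j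
      have hcard : (A.card : ℝ) ≤ (reach G S A j).card := by
        exact_mod_cast Finset.card_le_card hsub
      have h2 := hS _ (reach_subset (j := j)) (hne.mono hsub) (hσ.trans hcard)
        (by
          have := Finset.card_le_card (reach_mono (G := G) (S := S) (A := A)
            (show j ≤ m by omega))
          omega)
      have h3 : ((reach G S A j).card : ℝ) + (nbr G (reach G S A j) ∩ S).card
          ≤ (reach G S A (j + 1)).card := by
        exact_mod_cast card_reach_succ j
      rw [pow_succ]
      nlinarith
  have h1 := key m le_rfl
  have h2 : ((reach G S A m).card : ℝ) ≤ Fintype.card V := by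
    exact_mod_cast Finset.card_le_univ _
  linarith

/-- Two large sets are joined by a short walk. -/
theorem ExpandsOn.exists_walkIn {S A B : Finset V} {η σ : ℝ} (hS : ExpandsOn G S η σ)
    (hη : 0 ≤ η) (hA : A ⊆ S) (hAne : A.Nonempty) (hAσ : σ ≤ A.card)
    (hB : B ⊆ S) (hBne : B.Nonempty) (hBσ : σ ≤ B.card) {m : ℕ}
    (hm : (Fintype.card V : ℝ) < (1 + η) ^ m) :
    ∃ u ∈ A, ∃ v ∈ B, WalkIn G S u v (2 * m) := by
  have h1 := hS.lt_two_mul_card_reach hη hA hAne hAσ hm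
  have h2 := hS.lt_two_mul_card_reach hη hB hBne hBσ hm
  have hne : (reach G S A m ∩ reach G S B m).Nonempty := by
    rw [← Finset.card_pos]
    have h3 := Finset.card_union_add_card_inter (reach G S A m) (reach G S B m)
    have h4 := Finset.card_le_univ (reach G S A m ∪ reach G S B m)
    omega
  obtain ⟨x, hx⟩ := hne
  obtain ⟨hxA, hxB⟩ := Finset.mem_inter.1 hx
  obtain ⟨u, hu, hux⟩ := mem_reach.1 hxA
  obtain ⟨v, hv, hvx⟩ := mem_reach.1 hxB
  exact ⟨u, hu, v, hv, (hux.trans hvx.symm).mono subset_rfl (by omega)⟩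

/-- Every vertex lies in a connected set of any prescribed size and of small radius. -/
theorem ExpandsOn.exists_isBlob {S : Finset V} {η : ℝ} (hS : ExpandsOn G S η 1) (hη : 0 ≤ η)
    {c : V} (hc : c ∈ S) {m : ℕ} (hm : (Fintype.card V : ℝ) < (1 + η) ^ m) {M : ℕ}
    (hM : 1 ≤ M) (hM2 : 2 * M ≤ Fintype.card V) :
    ∃ Y ⊆ S, Y.card = M ∧ IsBlob G Y c m := by
  have hcS : {c} ⊆ S := Finset.singleton_subset_iff.2 hc
  have hbig := hS.lt_two_mul_card_reach hη hcS (Finset.singleton_nonempty c) (by simp) hm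
  have hblob : ∀ j, IsBlob G (reach G S {c} j) c j := fun j =>
    isBlob_filter hc fun v => by simp [mem_reach]
  have hex : ∃ j, M ≤ (reach G S {c} j).card := ⟨m, by omega⟩
  have hjm : Nat.find hex ≤ m := Nat.find_min' hex (by omega)
  have hspec := Nat.find_spec hex
  have hmin := fun i (hi : i < Nat.find hex) => Nat.find_min hex hi
  generalize Nat.find hex = j at hjm hspec hmin
  rcases j with _ | i
  · have h0 : reach G S {c} 0 ⊆ {c} := by
      intro v hv
      obtain ⟨u, hu, w, hl, -⟩ := mem_reach.1 hv
      have := SimpleGraph.Walk.eq_of_length_eq_zero (Nat.le_zero.1 hl)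
      simp_all
    have h1 := Finset.card_le_card h0
    rw [Finset.card_singleton] at h1
    exact ⟨_, reach_subset, by omega, (hblob 0).mono (by omega)⟩
  · obtain ⟨Y, hY1, hY2, hYc⟩ := Finset.exists_subsuperset_card_eq
      (reach_mono (G := G) (S := S) (A := {c}) (Nat.le_succ i))
      (le_of_not_ge (hmin i (Nat.lt_succ_self i))) hspec
    refine ⟨Y, hY2.trans reach_subset, hYc, hY1 (hblob i).1, fun v hv => ?_⟩
    obtain ⟨u, hu, w, hl, hs⟩ := mem_reach.1 (hY2 hv)
    obtain rfl := Finset.mem_singleton.1 hu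
    rcases Nat.lt_or_ge i w.length with hlt | hle
    · have hnil : ¬ w.Nil := by
        rw [← SimpleGraph.Walk.length_eq_zero_iff]; omega
      have hpen : WalkIn G S u w.penultimate i :=
        ⟨w.dropLast, by rw [SimpleGraph.Walk.length_dropLast]; omega, fun x hx =>
          hs x (List.dropLast_subset _ (w.support_dropLast hnil ▸ hx))⟩
      have hmem : w.penultimate ∈ reach G S {u} i := mem_reach.2 ⟨u, hu, hpen⟩
      exact (((hblob i).2 _ hmem).snoc hY1 (w.adj_penultimate hnil) hv).mono subset_rfl (by omega)
    · exact ((hblob i).2 v (mem_reach.2 ⟨u, hu, w, hle, hs⟩)).mono hY1 (by omega)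

/-- Deleting few vertices from an expanding graph leaves most of the large sets expanding. -/
theorem expandsOn_compl {ε : ℝ} (hε : 0 < ε)
    (hG : ∀ X : Finset V, X.Nonempty → 2 * X.card ≤ Fintype.card V →
      ε * X.card ≤ (nbr G X).card) {Z : Finset V} {σ : ℝ} (hσ : 2 * Z.card ≤ ε * σ) :
    ExpandsOn G Zᶜ (ε / 4) σ := by
  intro X _ hne hXσ hX
  have h1 := hG X hne hX
  have h2 : ((nbr G X).card : ℝ) ≤ (nbr G X ∩ Zᶜ).card + Z.card := by
    have h3 : nbr G X ⊆ (nbr G X ∩ Zᶜ) ∪ Z := by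
      intro v hv
      by_cases hvZ : v ∈ Z <;> simp [hv, hvZ]
    exact_mod_cast (Finset.card_le_card h3).trans (Finset.card_union_le _ _)
  nlinarith

/-- After deleting few vertices from an expanding graph, there remains a large subset which
expands at all scales. -/
theorem exists_expandsOn {ε : ℝ} (hε : 0 < ε) (hε1 : ε ≤ 1) [Nonempty V]
    (hG : ∀ X : Finset V, X.Nonempty → 2 * X.card ≤ Fintype.card V →
      ε * X.card ≤ (nbr G X).card) {Z : Finset V}
    (hZ : 16 * (Z.card : ℝ) ≤ ε ^ 2 * Fintype.card V) :
    ∃ K : Finset V, Disjoint K Z ∧ ExpandsOn G K (ε / 4) 1 ∧ Fintype.card V < 2 * K.card := by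
  set n := Fintype.card V with hn
  have hnpos : (0 : ℝ) < n := by exact_mod_cast Fintype.card_pos
  set F : Finset (Finset V) := Finset.univ.filter fun B =>
    B ⊆ Zᶜ ∧ 2 * B.card ≤ n ∧ ((nbr G B ∩ Zᶜ).card : ℝ) ≤ ε / 4 * B.card with hF
  have hF0 : ∅ ∈ F := by
    have : nbr G (∅ : Finset V) = ∅ := by
      ext v; simp [mem_nbr]
    simp [hF, this]
  obtain ⟨B, hBF, hBmax⟩ := Finset.exists_max_image F Finset.card ⟨_, hF0⟩
  obtain ⟨hBZ, hB2, hBn⟩ : B ⊆ Zᶜ ∧ 2 * B.card ≤ n ∧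
      ((nbr G B ∩ Zᶜ).card : ℝ) ≤ ε / 4 * B.card := by simpa [hF] using hBF
  have hZsplit : ∀ X : Finset V, ((nbr G X).card : ℝ) ≤ (nbr G X ∩ Zᶜ).card + Z.card := by
    intro X
    have h3 : nbr G X ⊆ (nbr G X ∩ Zᶜ) ∪ Z := by
      intro v hv
      by_cases hvZ : v ∈ Z <;> simp [hv, hvZ]
    exact_mod_cast (Finset.card_le_card h3).trans (Finset.card_union_le _ _)
  have hBsmall : ε * B.card ≤ 2 * Z.card := by
    rcases B.eq_empty_or_nonempty with rfl | hne
    · simp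
    · have := hG B hne hB2
      have := hZsplit B
      nlinarith
  have hZn : 16 * (Z.card : ℝ) ≤ ε * n := by nlinarith
  have hBn8 : 8 * (B.card : ℝ) ≤ ε * n := by
    have : ε * (8 * (B.card : ℝ)) ≤ ε * (ε * n) := by nlinarith
    exact le_of_mul_le_mul_left this hε
  have hεn : ε * n ≤ n := by nlinarith
  refine ⟨Zᶜ \ B, ?_, ?_, ?_⟩
  · exact Finset.disjoint_left.2 fun x hx hxZ => by simp [hxZ] at hx
  · intro X hXK hne _ hX2
    by_contra! hcon
    have hXB : Disjoint B X := Finset.disjoint_left.2 fun x hxB hxX => by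
      have := hXK hxX
      simp [hxB] at this
    have hcard : (B ∪ X).card = B.card + X.card := Finset.card_union_of_disjoint hXB
    have hXpos : 0 < X.card := hne.card_pos
    rcases Nat.lt_or_ge n (2 * (B ∪ X).card) with hbig | hsmall
    · rw [hcard] at hbig
      have hbig' : (n : ℝ) < 2 * (B.card + X.card) := by exact_mod_cast hbig
      have h1 := hG X hne hX2
      have h2 : ((nbr G X).card : ℝ) ≤ (nbr G X ∩ (Zᶜ \ B)).card + (Z.card + B.card) := by
        have h3 : nbr G X ⊆ (nbr G X ∩ (Zᶜ \ B)) ∪ (Z ∪ B) := by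
          intro v hv
          by_cases hvZ : v ∈ Z <;> by_cases hvB : v ∈ B <;> simp [hv, hvZ, hvB]
        have h4 := Finset.card_union_le Z B
        have h5 := (Finset.card_le_card h3).trans (Finset.card_union_le _ _)
        exact_mod_cast h5.trans (by omega)
      have hX4 : (n : ℝ) ≤ 4 * X.card := by linarith
      nlinarith
    · have hmem : B ∪ X ∈ F := by
        simp only [hF, Finset.mem_filter, Finset.mem_univ, true_and]
        refine ⟨Finset.union_subset hBZ (hXK.trans Finset.sdiff_subset), hsmall, ?_⟩
        have h3 : nbr G (B ∪ X) ∩ Zᶜ ⊆ (nbr G B ∩ Zᶜ) ∪ (nbr G X ∩ (Zᶜ \ B)) := by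
          intro v hv
          simp only [Finset.mem_inter, mem_nbr, Finset.mem_union, Finset.mem_sdiff] at hv ⊢
          obtain ⟨⟨hv1, u, hu, huv⟩, hv2⟩ := hv
          rcases hu with hu | hu
          · exact Or.inl ⟨⟨fun h => hv1 (Or.inl h), u, hu, huv⟩, hv2⟩
          · exact Or.inr ⟨⟨fun h => hv1 (Or.inr h), u, hu, huv⟩, hv2, fun h => hv1 (Or.inl h)⟩
        have h4 : ((nbr G (B ∪ X) ∩ Zᶜ).card : ℝ) ≤
            (nbr G B ∩ Zᶜ).card + (nbr G X ∩ (Zᶜ \ B)).card := by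
          exact_mod_cast (Finset.card_le_card h3).trans (Finset.card_union_le _ _)
        rw [hcard]
        push_cast
        nlinarith
      have := hBmax _ hmem
      omega
  · have h1 : (Zᶜ \ B).card + B.card = Zᶜ.card := Finset.card_sdiff_add_card_eq_card hBZ
    have h2 : Zᶜ.card + Z.card = n := by
      rw [Finset.card_compl]
      have := Finset.card_le_univ Z
      omega
    have h3 : ((Zᶜ \ B).card : ℝ) + B.card + Z.card = n := by
      exact_mod_cast (by omega : (Zᶜ \ B).card + B.card + Z.card = n)
    have : (n : ℝ) < 2 * (Zᶜ \ B).card := by linarith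
    exact_mod_cast this

end Expansion


section Disjoint

variable [DecidableEq V]

theorem exists_pairwise_disjoint {P : Finset V → Prop} {c f : ℕ}
    (h : ∀ T : Finset V, T.card ≤ f * c → ∃ R, P R ∧ R.card ≤ c ∧ Disjoint R T) :
    ∃ g : ℕ → Finset V, (∀ j < f, P (g j) ∧ (g j).card ≤ c) ∧
      ∀ j < f, ∀ i < j, Disjoint (g i) (g j) := by
  suffices ∀ k ≤ f, ∃ g : ℕ → Finset V, (∀ j < k, P (g j) ∧ (g j).card ≤ c) ∧
      ∀ j < k, ∀ i < j, Disjoint (g i) (g j) from this f le_rfl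
  intro k
  induction k with
  | zero => exact fun _ => ⟨fun _ => ∅, by simp, by simp⟩
  | succ k ih =>
    intro hk
    obtain ⟨g, hg, hd⟩ := ih (by omega)
    obtain ⟨R, hP, hRc, hR⟩ := h ((Finset.range k).biUnion g) <| by
      refine (Finset.card_biUnion_le_card_mul _ _ c fun j hj => (hg j (by simpa using hj)).2).trans
        ?_
      rw [Finset.card_range]
      exact Nat.mul_le_mul_right c (by omega)
    refine ⟨Function.update g k R, fun j hj => ?_, fun j hj i hi => ?_⟩
    · rcases eq_or_ne j k with rfl | hne
      · simpa using ⟨hP, hRc⟩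
      · simpa [hne] using hg j (by omega)
    · have hik : i ≠ k := by omega
      rcases eq_or_ne j k with rfl | hne
      · rw [Function.update_self, Function.update_of_ne hik]
        exact (Finset.disjoint_biUnion_right _ _ _ |>.1 hR i (by simpa using hi)).symm
      · rw [Function.update_of_ne hik, Function.update_of_ne hne]
        exact hd j (by omega) i hi

/-- A set `s` meets at most `|s|` members of a pairwise disjoint family. -/
theorem card_filter_not_disjoint_le {R : ℕ → Finset V} {f : ℕ}
    (hR : ∀ j < f, ∀ i < j, Disjoint (R i) (R j)) (s : Finset V) :
    ((Finset.range f).filter fun j => ¬ Disjoint s (R j)).card ≤ s.card := by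
  have hdis : ∀ i ∈ (Finset.range f).filter (fun j => ¬ Disjoint s (R j)),
      ∀ j ∈ (Finset.range f).filter (fun j => ¬ Disjoint s (R j)), i ≠ j →
      Disjoint (s ∩ R i) (s ∩ R j) := by
    intro i hi j hj hij
    simp only [Finset.mem_filter, Finset.mem_range] at hi hj
    refine Disjoint.mono Finset.inter_subset_right Finset.inter_subset_right ?_
    rcases lt_or_gt_of_ne hij with hlt | hlt
    · exact hR j hj.1 i hlt
    · exact (hR i hi.1 j hlt).symm
  calc _ = ∑ j ∈ (Finset.range f).filter (fun j => ¬ Disjoint s (R j)), 1 := by simp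
    _ ≤ ∑ j ∈ (Finset.range f).filter (fun j => ¬ Disjoint s (R j)), (s ∩ R j).card := by
      refine Finset.sum_le_sum fun j hj => ?_
      have := (Finset.mem_filter.1 hj).2
      rwa [Finset.disjoint_iff_inter_eq_empty, ← ne_eq, ← Finset.nonempty_iff_ne_empty,
        ← Finset.card_pos] at this
    _ = (((Finset.range f).filter fun j => ¬ Disjoint s (R j)).biUnion fun j => s ∩ R j).card :=
      (Finset.card_biUnion hdis).symm
    _ ≤ s.card := Finset.card_le_card (Finset.biUnion_subset.2 fun _ _ => Finset.inter_subset_left)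

end Disjoint

section Blobs

variable [Fintype V] [DecidableEq V] {G : SimpleGraph V}

/-- Every nonempty vertex set of at most half of the graph has at least `ε |X|` and at least `κ`
external neighbours, and `m` is large enough for balls of radius `m` to cover half of the graph. -/
structure IsRobust (G : SimpleGraph V) (ε κ : ℝ) (m : ℕ) : Prop where
  pos : 0 < ε
  le_one : ε ≤ 1
  mul_le_card_nbr : ∀ X : Finset V, X.Nonempty → 2 * X.card ≤ Fintype.card V →
    ε * X.card ≤ (nbr G X).card
  le_card_nbr : ∀ X : Finset V, X.Nonempty → 2 * X.card ≤ Fintype.card V →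
    κ ≤ (nbr G X).card
  lt_pow : (Fintype.card V : ℝ) < (1 + ε / 4) ^ m

variable {ε κ : ℝ} {m : ℕ}

theorem IsRobust.expandsOn_compl (h : IsRobust G ε κ m) {W : Finset V}
    (hW : 2 * (W.card : ℝ) ≤ κ) : ExpandsOn G Wᶜ (ε / 4) 1 := by
  intro X _ hne _ hX
  have h0 := h.pos
  have h1 := h.mul_le_card_nbr X hne hX
  have h2 := h.le_card_nbr X hne hX
  have h3 : nbr G X ⊆ (nbr G X ∩ Wᶜ) ∪ W := by
    intro v hv
    by_cases hvW : v ∈ W <;> simp [hv, hvW]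
  have h4 : ((nbr G X).card : ℝ) ≤ (nbr G X ∩ Wᶜ).card + W.card := by
    exact_mod_cast (Finset.card_le_card h3).trans (Finset.card_union_le _ _)
  nlinarith [(Nat.cast_nonneg X.card : (0 : ℝ) ≤ X.card)]

/-- Some member of a large disjoint family can be deleted from a blob while keeping half of it. -/
theorem IsBlob.exists_avoiding {Y : Finset V} {r u : V} (hY : IsBlob G Y r m) (hu : u ∈ Y)
    {R : ℕ → Finset V} (hR : ∀ j < 4 * (m + 1), ∀ i < j, Disjoint (R i) (R j)) :
    ∃ j < 4 * (m + 1), ∃ X ⊆ Y \ R j, Y.card ≤ 2 * X.card ∧ IsBlob G X u (m + m) := by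
  classical
  have hs : ∀ v ∈ Y, ∃ s ⊆ Y, s.card ≤ m + 1 ∧ WalkIn G s r v m := by
    intro v hv
    obtain ⟨K, hK, hp⟩ := (hY.2 v hv).exists_pathIn
    obtain ⟨T, hT, hTc, hvT, hblob⟩ := hp.exists_isBlob
    exact ⟨T, hT, by omega, (hblob.2 v hvT).mono subset_rfl hK⟩
  choose! s hsY hsc hsw using hs
  set bad : ℕ → Finset V := fun j => Y.filter fun v => ¬ Disjoint (s v) (R j) with hbad
  set f := 4 * (m + 1) with hf
  have hYpos : 0 < Y.card := Finset.card_pos.2 ⟨u, hu⟩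
  have hsum1 : ∑ j ∈ Finset.range f, (bad j).card ≤ Y.card * (m + 1) := by
    calc _ = ∑ j ∈ Finset.range f, ∑ v ∈ Y, if ¬ Disjoint (s v) (R j) then 1 else 0 := by
          simp only [hbad, Finset.card_filter]
      _ = ∑ v ∈ Y, ∑ j ∈ Finset.range f, if ¬ Disjoint (s v) (R j) then 1 else 0 :=
          Finset.sum_comm
      _ ≤ ∑ v ∈ Y, (m + 1) := Finset.sum_le_sum fun v hv => by
          rw [← Finset.card_filter]
          exact (card_filter_not_disjoint_le hR (s v)).trans (hsc v hv)
      _ = Y.card * (m + 1) := by rw [Finset.sum_const, smul_eq_mul]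
  have hsum2 : ∑ j ∈ Finset.range f, (if ¬ Disjoint (s u) (R j) then Y.card else 0)
      ≤ Y.card * (m + 1) := by
    rw [← Finset.sum_filter, Finset.sum_const, smul_eq_mul, mul_comm]
    exact Nat.mul_le_mul_left _ ((card_filter_not_disjoint_le hR (s u)).trans (hsc u hu))
  obtain ⟨j, hj, hjb⟩ : ∃ j ∈ Finset.range f,
      2 * ((bad j).card + if ¬ Disjoint (s u) (R j) then Y.card else 0) ≤ Y.card := by
    refine Finset.exists_le_of_sum_le (by simp [hf]) ?_
    rw [← Finset.mul_sum, Finset.sum_add_distrib, Finset.sum_const, Finset.card_range, smul_eq_mul,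
      hf]
    nlinarith
  have hgood : ∀ v ∈ Y, Disjoint (s v) (R j) → WalkIn G (Y \ R j) r v m := fun v hv hd =>
    (hsw v hv).mono (fun x hx => Finset.mem_sdiff.2
      ⟨hsY v hv hx, Finset.disjoint_left.1 hd hx⟩) le_rfl
  have hugood : Disjoint (s u) (R j) := by
    by_contra hcon
    rw [if_pos hcon] at hjb
    omega
  obtain ⟨w, hw⟩ := hgood u hu hugood
  have hr : r ∈ Y \ R j := hw.2 r w.start_mem_support
  set X : Finset V := Finset.univ.filter fun v => WalkIn G (Y \ R j) r v m with hX
  have hblob : IsBlob G X r m := isBlob_filter hr fun v => by simp [hX]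
  refine ⟨j, Finset.mem_range.1 hj, X, fun v hv => ?_, ?_, hblob.reroot ?_⟩
  · exact (Finset.mem_filter.1 hv).2.right_mem
  · have h1 : Y \ bad j ⊆ X := fun v hv => by
      simp only [hbad, Finset.mem_sdiff, Finset.mem_filter, not_and, not_not] at hv
      simpa [hX] using hgood v hv.1 (hv.2 hv.1)
    have h2 := Finset.card_le_card h1
    have h3 := Finset.le_card_sdiff (bad j) Y
    omega
  · simpa [hX] using hgood u hu hugood

theorem IsRobust.exists_disjoint_blobs_of_path (h : IsRobust G ε κ m) {W : Finset V} {a b : V}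
    (hb : b ∉ W) {Y₁ Y₂ T : Finset V} {r₁ r₂ u : V} {M : ℕ}
    (hM : 4 * (m + 1) * (2 * m + 1) < M)
    (hW : 2 * ((W.card : ℝ) + (2 * m + 1) + 4 * (m + 1) * (2 * m + 1)) ≤ κ)
    (hY₁ : IsBlob G Y₁ r₁ m) (hY₂ : IsBlob G Y₂ r₂ m) (hYd : Disjoint Y₁ Y₂)
    (hY₁W : Disjoint Y₁ W) (hY₂W : Disjoint Y₂ W) (hbY₁ : b ∉ Y₁) (hbY₂ : b ∉ Y₂)
    (hY₁M : Y₁.card = M) (hY₂M : Y₂.card = M)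
    (hT : IsBlob G T a (2 * m)) (hTc : T.card ≤ 2 * m + 1) (huT : u ∈ T) (huY : u ∈ Y₁)
    (hTW : Disjoint T W) (hTb : b ∉ T) (hTY : Disjoint T Y₂) :
    ∃ Xa Xb : Finset V, Disjoint Xa Xb ∧ Disjoint Xa W ∧ Disjoint Xb W ∧
      IsBlob G Xa a (4 * m) ∧ IsBlob G Xb b (4 * m) ∧ M ≤ 2 * Xa.card ∧ M ≤ 2 * Xb.card ∧
      Xa.card ≤ M + 2 * m + 2 ∧ Xb.card ≤ M + 2 * m + 2 := by
  obtain ⟨R, hRP, hRd⟩ := exists_pairwise_disjoint (c := 2 * m + 1) (f := 4 * (m + 1))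
    (P := fun R : Finset V => Disjoint R (W ∪ T) ∧ IsBlob G (insert b R) b (2 * m) ∧
      ∃ z ∈ R, z ∈ Y₂) (by
    intro Q hQ
    have hcard : (((W ∪ T ∪ Q).erase b).card : ℝ) ≤
        W.card + (2 * m + 1) + 4 * (m + 1) * (2 * m + 1) := by
      have h1 := (Finset.card_erase_le (s := W ∪ T ∪ Q) (a := b)).trans
        (Finset.card_union_le _ _)
      have h2 := Finset.card_union_le W T
      exact_mod_cast (by omega : ((W ∪ T ∪ Q).erase b).card ≤
        W.card + (2 * m + 1) + 4 * (m + 1) * (2 * m + 1))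
    have hexp := h.expandsOn_compl (W := (W ∪ T ∪ Q).erase b) (by linarith)
    have hne : (Y₂ \ Q).Nonempty := by
      rw [← Finset.card_pos]
      have := Finset.le_card_sdiff Q Y₂
      omega
    have hsub : Y₂ \ Q ⊆ ((W ∪ T ∪ Q).erase b)ᶜ := by
      intro x hx
      obtain ⟨hx1, hx2⟩ := Finset.mem_sdiff.1 hx
      simp [Finset.disjoint_left.1 hY₂W hx1, Finset.disjoint_right.1 hTY hx1, hx2]
    obtain ⟨b', hb', z, hz, hw⟩ := hexp.exists_walkIn (by linarith [h.pos])
      (Finset.singleton_subset_iff.2 (by simp)) (Finset.singleton_nonempty b) (by simp)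
      hsub hne (by exact_mod_cast hne.card_pos) h.lt_pow
    obtain rfl := Finset.mem_singleton.1 hb'
    obtain ⟨K, hK, hp⟩ := hw.exists_pathIn
    obtain ⟨S, hS, hSc, hzS, hblob⟩ := hp.exists_isBlob
    obtain ⟨hz1, hz2⟩ := Finset.mem_sdiff.1 hz
    have havoid : ∀ x ∈ S.erase b', x ∉ W ∧ x ∉ T ∧ x ∉ Q := by
      intro x hx
      obtain ⟨hxb, hxS⟩ := Finset.mem_erase.1 hx
      have := hS hxS
      simp only [Finset.mem_compl, Finset.mem_erase, Finset.mem_union] at this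
      tauto
    refine ⟨S.erase b', ⟨?_, ?_, z, ?_, hz1⟩, ?_, ?_⟩
    · exact Finset.disjoint_left.2 fun x hx => by simpa using ⟨(havoid x hx).1, (havoid x hx).2.1⟩
    · rw [Finset.insert_erase hblob.1]
      exact hblob.mono hK
    · exact Finset.mem_erase.2 ⟨fun hzb => hbY₂ (hzb ▸ hz1), hzS⟩
    · have := Finset.card_erase_le (s := S) (a := b')
      omega
    · exact Finset.disjoint_left.2 fun x hx => (havoid x hx).2.2)
  obtain ⟨j, hj, X, hXsub, hXc, hX⟩ := hY₁.exists_avoiding huY hRd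
  obtain ⟨⟨hRWT, hRb, z, hzR, hzY⟩, hRc⟩ := hRP j hj
  obtain ⟨hRW, hRT⟩ := Finset.disjoint_union_right.1 hRWT
  have hXY : X ⊆ Y₁ := hXsub.trans Finset.sdiff_subset
  have hXR : Disjoint X (R j) :=
    Finset.disjoint_left.2 fun x hx => (Finset.mem_sdiff.1 (hXsub hx)).2
  refine ⟨T ∪ X, insert b (R j) ∪ Y₂, ?_, ?_, ?_, ?_, ?_, ?_, ?_, ?_, ?_⟩
  · rw [Finset.disjoint_union_left, Finset.disjoint_union_right, Finset.disjoint_union_right,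
      Finset.disjoint_insert_right, Finset.disjoint_insert_right]
    exact ⟨⟨⟨hTb, hRT.symm⟩, hTY⟩, ⟨fun hbX => hbY₁ (hXY hbX), hXR⟩, hYd.mono_left hXY⟩
  · exact Finset.disjoint_union_left.2 ⟨hTW, hY₁W.mono_left hXY⟩
  · simp only [Finset.disjoint_union_left, Finset.disjoint_insert_left]
    exact ⟨⟨hb, hRW⟩, hY₂W⟩
  · exact (hT.union hX huT).mono (by omega)
  · exact (hRb.union (hY₂.reroot hzY) (Finset.mem_insert_of_mem hzR)).mono (by omega)
  · have := Finset.card_le_card (Finset.subset_union_right (s₁ := T) (s₂ := X))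
    omega
  · have := Finset.card_le_card (Finset.subset_union_right (s₁ := insert b (R j)) (s₂ := Y₂))
    omega
  · have := Finset.card_union_le T X
    have := Finset.card_le_card hXY
    omega
  · have := Finset.card_union_le (insert b (R j)) Y₂
    have := Finset.card_insert_le b (R j)
    omega

/-- Two distinct vertices are contained in disjoint large sets of small radius. -/
theorem IsRobust.exists_disjoint_blobs [Nonempty V] (h : IsRobust G ε κ m) {W : Finset V}
    {a b : V} (hab : a ≠ b) (ha : a ∉ W) (hb : b ∉ W) {M : ℕ}
    (hM : 4 * (m + 1) * (2 * m + 1) < M) (hM2 : 2 * M ≤ Fintype.card V)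
    (hW : 2 * ((W.card : ℝ) + (2 * m + 1) + 4 * (m + 1) * (2 * m + 1)) ≤ κ)
    (hMW : 16 * ((W.card : ℝ) + 2 + M) ≤ ε ^ 2 * Fintype.card V) :
    ∃ Xa Xb : Finset V, Disjoint Xa Xb ∧ Disjoint Xa W ∧ Disjoint Xb W ∧
      IsBlob G Xa a (4 * m) ∧ IsBlob G Xb b (4 * m) ∧ M ≤ 2 * Xa.card ∧ M ≤ 2 * Xb.card ∧
      Xa.card ≤ M + 2 * m + 2 ∧ Xb.card ≤ M + 2 * m + 2 := by
  have hblob : ∀ Z : Finset V, (Z.card : ℝ) ≤ W.card + 2 + M →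
      ∃ Y r, Disjoint Y Z ∧ Y.card = M ∧ IsBlob G Y r m := by
    intro Z hZ
    obtain ⟨K, hKZ, hK, hKc⟩ := exists_expandsOn h.pos h.le_one h.mul_le_card_nbr
      (Z := Z) (by linarith)
    obtain ⟨c, hc⟩ := Finset.card_pos.1 (by omega : 0 < K.card)
    obtain ⟨Y, hYK, hYM, hY⟩ := hK.exists_isBlob (by linarith [h.pos]) hc h.lt_pow
      (by omega) hM2
    exact ⟨Y, c, hKZ.mono_left hYK, hYM, hY⟩
  have hc2 : (insert a (insert b W)).card ≤ W.card + 2 := by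
    have := Finset.card_insert_le a (insert b W)
    have := Finset.card_insert_le b W
    omega
  obtain ⟨Y₁, r₁, hY₁Z, hY₁M, hY₁⟩ := hblob (insert a (insert b W)) (by
    exact_mod_cast (by omega : (insert a (insert b W)).card ≤ W.card + 2 + M))
  obtain ⟨Y₂, r₂, hY₂Z, hY₂M, hY₂⟩ := hblob (insert a (insert b W) ∪ Y₁) (by
    have := Finset.card_union_le (insert a (insert b W)) Y₁
    exact_mod_cast (by omega : (insert a (insert b W) ∪ Y₁).card ≤ W.card + 2 + M))
  simp only [Finset.disjoint_union_right, Finset.disjoint_insert_right] at hY₁Z hY₂Z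
  obtain ⟨haY₁, hbY₁, hY₁W⟩ := hY₁Z
  obtain ⟨⟨haY₂, hbY₂, hY₂W⟩, hY₂₁⟩ := hY₂Z
  have hexp := h.expandsOn_compl (W := insert b W) (by
    have : ((insert b W).card : ℝ) ≤ W.card + 1 := by exact_mod_cast Finset.card_insert_le b W
    nlinarith [(Nat.cast_nonneg m : (0 : ℝ) ≤ m)])
  have hsub : Y₁ ∪ Y₂ ⊆ (insert b W)ᶜ := by
    intro x hx
    simp only [Finset.mem_compl, Finset.mem_insert, not_or]
    rcases Finset.mem_union.1 hx with hx | hx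
    · exact ⟨fun hxb => hbY₁ (hxb ▸ hx), Finset.disjoint_left.1 hY₁W hx⟩
    · exact ⟨fun hxb => hbY₂ (hxb ▸ hx), Finset.disjoint_left.1 hY₂W hx⟩
  have hne : (Y₁ ∪ Y₂).Nonempty := ⟨r₁, Finset.mem_union_left _ hY₁.1⟩
  obtain ⟨a', ha', u, hu, T, hTS, K, hK, hp, hTc, -, hTY⟩ := exists_minimal_pathIn
    (hexp.exists_walkIn (by linarith [h.pos]) (A := {a})
      (Finset.singleton_subset_iff.2 (by simp [hab, ha])) (Finset.singleton_nonempty a) (by simp)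
      hsub hne (by exact_mod_cast hne.card_pos) h.lt_pow)
  obtain rfl := Finset.mem_singleton.1 ha'
  obtain ⟨T', hTT', hT'c, huT', hT'⟩ := hp.exists_isBlob
  have hT'W : Disjoint T' W := Finset.disjoint_left.2 fun x hx hxW => by
    have := hTS (hTT' hx)
    simp [hxW] at this
  have hT'b : b ∉ T' := fun hbT => by
    have := hTS (hTT' hbT)
    simp at this
  rcases Finset.mem_union.1 hu with hu1 | hu2
  · refine h.exists_disjoint_blobs_of_path hb hM hW hY₁ hY₂ hY₂₁.symm hY₁W hY₂W hbY₁ hbY₂ hY₁M hY₂M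
      (hT'.mono hK) (by omega) huT' hu1 hT'W hT'b (Finset.disjoint_left.2 fun x hx hxY => ?_)
    obtain rfl := hTY x (hTT' hx) (Finset.mem_union_right _ hxY)
    exact Finset.disjoint_left.1 hY₂₁ hxY hu1
  · refine h.exists_disjoint_blobs_of_path hb hM hW hY₂ hY₁ hY₂₁ hY₂W hY₁W hbY₂ hbY₁ hY₂M hY₁M
      (hT'.mono hK) (by omega) huT' hu2 hT'W hT'b (Finset.disjoint_left.2 fun x hx hxY => ?_)
    obtain rfl := hTY x (hTT' hx) (Finset.mem_union_left _ hxY)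
    exact Finset.disjoint_left.1 hY₂₁ hu2 hxY

end Blobs

section LongPath

variable [Fintype V] [DecidableEq V] {G : SimpleGraph V} {ε κ : ℝ} {m : ℕ}

/-- The set `T` carries a path of length `L` from `a` to `y`, and `y` is its only vertex in the
large expanding set `K`; everything avoids `Q`. -/
structure IsExtendable (G : SimpleGraph V) (ε : ℝ) (Q : Finset V) (a y : V) (L : ℕ)
    (T K : Finset V) : Prop where
  path : PathIn G T a y L
  card_eq : T.card = L + 1
  mem : y ∈ K
  eq_of_mem : ∀ x ∈ T, x ∈ K → x = y
  disjoint_left : Disjoint T Q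
  disjoint_right : Disjoint K Q
  expandsOn : ExpandsOn G K (ε / 4) 1
  lt_card : Fintype.card V < 2 * K.card

theorem IsRobust.exists_isExtendable_succ [Nonempty V] (h : IsRobust G ε κ m) {Q : Finset V}
    {a y : V} {L : ℕ} {T K : Finset V} (hT : IsExtendable G ε Q a y L T K)
    (hQ : 16 * ((Q.card : ℝ) + L + 1) ≤ ε ^ 2 * Fintype.card V) :
    ∃ y' L' T' K', L < L' ∧ L' ≤ L + 2 * m ∧ IsExtendable G ε Q a y' L' T' K' := by
  obtain ⟨K', hK'd, hK', hK'c⟩ := exists_expandsOn h.pos h.le_one h.mul_le_card_nbr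
    (Z := Q ∪ T) (by
      have h1 := Finset.card_union_le Q T
      have h2 := hT.card_eq
      have h3 : ((Q ∪ T).card : ℝ) ≤ Q.card + L + 1 := by
        exact_mod_cast (by omega : (Q ∪ T).card ≤ Q.card + L + 1)
      linarith)
  obtain ⟨hK'Q, hK'T⟩ := Finset.disjoint_union_right.1 hK'd
  have hne : (K ∩ K').Nonempty := by
    rw [← Finset.card_pos]
    have h1 := Finset.card_union_add_card_inter K K'
    have h2 := Finset.card_le_univ (K ∪ K')
    have h3 := hT.lt_card
    omega
  obtain ⟨y₀, hy₀, y', hy', S, hSK, k, hk, hp, -, -, hSK'⟩ := exists_minimal_pathIn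
    (hT.expandsOn.exists_walkIn (by linarith [h.pos]) (A := {y})
      (Finset.singleton_subset_iff.2 hT.mem) (Finset.singleton_nonempty y) (by simp)
      Finset.inter_subset_left hne (by exact_mod_cast hne.card_pos) h.lt_pow)
  obtain rfl := Finset.mem_singleton.1 hy₀
  have hy'K' := (Finset.mem_inter.1 hy').2
  have hkpos : 0 < k := by
    rcases Nat.eq_zero_or_pos k with rfl | hk
    · obtain rfl := hp.eq_of_zero
      exact absurd hT.path.right_mem (Finset.disjoint_left.1 hK'T hy'K')
    · exact hk
  obtain ⟨T', hT', hT'c, hp'⟩ := (hT.path.append hp fun x hx hxS =>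
    hT.eq_of_mem x hx (hSK hxS)).exists_exact
  refine ⟨y', L + k, T', K', by omega, by omega, hp', hT'c, hy'K', fun x hx hxK' => ?_, ?_, hK'Q,
    hK', hK'c⟩
  · rcases Finset.mem_union.1 (hT' hx) with hxT | hxS
    · exact absurd hxT (Finset.disjoint_left.1 hK'T hxK')
    · exact hSK' x hxS (Finset.mem_inter.2 ⟨hSK hxS, hxK'⟩)
  · exact (Finset.disjoint_union_left.2
      ⟨hT.disjoint_left, hT.disjoint_right.mono_left hSK⟩).mono_left hT'

theorem IsRobust.exists_isExtendable_of_le [Nonempty V] (h : IsRobust G ε κ m) {Q : Finset V}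
    {a y : V} {L₀ : ℕ} {T K : Finset V} (hT : IsExtendable G ε Q a y L₀ T K) {t : ℕ}
    (ht : L₀ ≤ t) (hQ : 16 * ((Q.card : ℝ) + t + 1) ≤ ε ^ 2 * Fintype.card V) :
    ∃ y' L' T' K', t ≤ L' ∧ L' ≤ t + 2 * m ∧ IsExtendable G ε Q a y' L' T' K' := by
  induction t, ht using Nat.le_induction with
  | base => exact ⟨y, L₀, T, K, le_rfl, by omega, hT⟩
  | succ t ht ih =>
    push_cast at hQ
    obtain ⟨y', L', T', K', h1, h2, hT'⟩ := ih (by linarith)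
    rcases Nat.lt_or_ge t L' with hlt | hle
    · exact ⟨y', L', T', K', hlt, by omega, hT'⟩
    · obtain rfl : L' = t := by omega
      obtain ⟨y₂, L₂, T₂, K₂, h3, h4, hT₂⟩ := h.exists_isExtendable_succ hT' (by linarith)
      exact ⟨y₂, L₂, T₂, K₂, h3, by omega, hT₂⟩

/-- An extendable path can be closed up to any large blob. -/
theorem IsExtendable.exists_pathIn (h : IsRobust G ε κ m) {W X : Finset V} {a b y : V} {L : ℕ}
    {T K : Finset V} (hT : IsExtendable G ε (W ∪ X) a y L T K) {ρ : ℕ} (hX : IsBlob G X b ρ)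
    (hXW : Disjoint X W) {σ : ℝ} (hσX : σ ≤ X.card) (hσK : σ ≤ K.card)
    (hσ : 2 * ((W.card : ℝ) + L) ≤ ε * σ) :
    ∃ q, L ≤ q ∧ q ≤ L + 4 * m + ρ ∧ PathIn G Wᶜ a b q := by
  obtain ⟨hTW, hTX⟩ := Finset.disjoint_union_right.1 hT.disjoint_left
  obtain ⟨hKW, hKX⟩ := Finset.disjoint_union_right.1 hT.disjoint_right
  have hyT := hT.path.right_mem
  have hexp := _root_.Balanced.expandsOn_compl h.pos h.mul_le_card_nbr (Z := W ∪ T.erase y)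
    (σ := σ) (by
      have h1 := Finset.card_union_le W (T.erase y)
      have h2 := Finset.card_erase_of_mem hyT
      have h3 := hT.card_eq
      have h4 : ((W ∪ T.erase y).card : ℝ) ≤ W.card + L := by
        exact_mod_cast (by omega : (W ∪ T.erase y).card ≤ W.card + L)
      linarith)
  have hη : 0 ≤ ε / 4 := by linarith [h.pos]
  obtain ⟨x, hx, z, hz, S, hS, k, hk, hp, -, hSX, hSK⟩ := exists_minimal_pathIn
    (hexp.exists_walkIn hη (A := X) (B := K) (fun x hx => by
        simp [Finset.disjoint_left.1 hXW hx, Finset.disjoint_right.1 hTX hx])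
      ⟨b, hX.1⟩ hσX (fun x hx => by
        have := hT.eq_of_mem x
        have := Finset.disjoint_left.1 hKW hx
        simp only [Finset.mem_compl, Finset.mem_union, Finset.mem_erase]
        tauto)
      ⟨y, hT.mem⟩ hσK h.lt_pow)
  have hSavoid : ∀ v ∈ S, v ∉ W ∧ (v ∈ T → v = y) := fun v hv => by
    have := hS hv
    simp only [Finset.mem_compl, Finset.mem_union, Finset.mem_erase] at this
    tauto
  obtain ⟨y₀, hy₀, z₀, hz₀, hw⟩ := hT.expandsOn.exists_walkIn hη (A := {y}) (B := {z})
    (Finset.singleton_subset_iff.2 hT.mem) (Finset.singleton_nonempty y) (by simp)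
    (Finset.singleton_subset_iff.2 hz) (Finset.singleton_nonempty z) (by simp) h.lt_pow
  obtain rfl := Finset.mem_singleton.1 hy₀
  obtain rfl := Finset.mem_singleton.1 hz₀
  obtain ⟨k₂, hk₂, hp₂⟩ := hw.exists_pathIn
  obtain ⟨k₃, hk₃, hp₃⟩ := (hX.2 x hx).symm.exists_pathIn
  have hpath := ((hT.path.append hp₂ hT.eq_of_mem).append hp.symm fun v hv hvS => by
    rcases Finset.mem_union.1 hv with hv | hv
    · obtain rfl := (hSavoid v hvS).2 hv
      exact hSK v hvS hT.mem
    · exact hSK v hvS hv).append hp₃ fun v hv hvX => by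
    rcases Finset.mem_union.1 hv with hv | hv
    · rcases Finset.mem_union.1 hv with hv | hv
      · exact absurd hvX (Finset.disjoint_left.1 hTX hv)
      · exact absurd hvX (Finset.disjoint_left.1 hKX hv)
    · exact hSX v hv hvX
  refine ⟨_, by omega, by omega, hpath.mono fun v hv => ?_⟩
  simp only [Finset.mem_union] at hv
  rw [Finset.mem_compl]
  rcases hv with ((hv | hv) | hv) | hv
  · exact Finset.disjoint_left.1 hTW hv
  · exact Finset.disjoint_left.1 hKW hv
  · exact (hSavoid v hv).1
  · exact Finset.disjoint_left.1 hXW hv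

theorem IsRobust.exists_pathIn_of_blobs [Nonempty V] (h : IsRobust G ε κ m)
    {W X X' T K : Finset V} {a b x y : V} {L t : ℕ}
    (hX : IsBlob G X a (4 * m)) (hX' : IsBlob G X' b (4 * m)) (hXX' : Disjoint X X')
    (hXW : Disjoint X W) (hX'W : Disjoint X' W)
    (hKW : Disjoint K W) (hKX : Disjoint K X) (hKX' : Disjoint K X')
    (hK : ExpandsOn G K (ε / 4) 1) (hKc : Fintype.card V < 2 * K.card)
    (hT : PathIn G T x y L) (hx : x ∈ X) (hy : y ∈ K) (hTW : Disjoint T W)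
    (hTX : ∀ v ∈ T, v ∈ X → v = x) (hTX' : Disjoint T X') (hTK : ∀ v ∈ T, v ∈ K → v = y)
    (hL : L ≤ 2 * m) (ht : 6 * m ≤ t)
    (hQ : 16 * ((W.card : ℝ) + X'.card + t + 1) ≤ ε ^ 2 * Fintype.card V)
    {σ : ℝ} (hσX' : σ ≤ X'.card) (hσn : σ ≤ Fintype.card V / 2)
    (hσ : 2 * ((W.card : ℝ) + t + 2 * m) ≤ ε * σ) :
    ∃ q, t ≤ q ∧ q ≤ t + 10 * m ∧ PathIn G Wᶜ a b q := by
  obtain ⟨k, hk, hp⟩ := (hX.2 x hx).exists_pathIn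
  obtain ⟨T₀, hT₀, hT₀c, hp₀⟩ := (hp.append hT fun v hv hvT => hTX v hvT hv).exists_exact
  have hext : IsExtendable G ε (W ∪ X') a y (k + L) T₀ K := by
    refine ⟨hp₀, hT₀c, hy, fun v hv hvK => ?_, ?_, ?_, hK, hKc⟩
    · rcases Finset.mem_union.1 (hT₀ hv) with hv | hv
      · exact absurd hv (Finset.disjoint_left.1 hKX hvK)
      · exact hTK v hv hvK
    · refine Disjoint.mono_left hT₀ ?_
      rw [Finset.disjoint_union_left, Finset.disjoint_union_right, Finset.disjoint_union_right]
      exact ⟨⟨hXW, hXX'⟩, hTW, hTX'⟩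
    · exact Finset.disjoint_union_right.2 ⟨hKW, hKX'⟩
  obtain ⟨y', L', T', K', h1, h2, hT'⟩ := h.exists_isExtendable_of_le hext (t := t) (by omega) (by
    have : ((W ∪ X').card : ℝ) ≤ W.card + X'.card := by
      exact_mod_cast Finset.card_union_le _ _
    linarith)
  have hK'c : (Fintype.card V : ℝ) < 2 * K'.card := by exact_mod_cast hT'.lt_card
  obtain ⟨q, hq1, hq2, hq⟩ := hT'.exists_pathIn h hX' hX'W hσX' (by linarith) (by
    have : (L' : ℝ) ≤ t + 2 * m := by exact_mod_cast h2
    linarith)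
  exact ⟨q, by omega, by omega, hq⟩

/-- Two vertices of a robust expander are joined by a path of nearly any prescribed length. -/
theorem IsRobust.exists_long_pathIn [Nonempty V] (h : IsRobust G ε κ m) {W : Finset V}
    {a b : V} (hab : a ≠ b) (ha : a ∉ W) (hb : b ∉ W) {M t : ℕ}
    (hM : 4 * (m + 1) * (2 * m + 1) < M) (hM2 : 2 * M ≤ Fintype.card V)
    (hW : 2 * ((W.card : ℝ) + (2 * m + 1) + 4 * (m + 1) * (2 * m + 1)) ≤ κ)
    (ht : 6 * m ≤ t)
    (hMW : 16 * ((W.card : ℝ) + 2 * (M + 2 * m + 2) + t + 1) ≤ ε ^ 2 * Fintype.card V)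
    (hMt : 2 * ((W.card : ℝ) + t + 2 * m) ≤ ε * (M / 2)) :
    ∃ q, t ≤ q ∧ q ≤ t + 10 * m ∧ PathIn G Wᶜ a b q := by
  have hm0 : (0 : ℝ) ≤ m := Nat.cast_nonneg m
  have ht0 : (0 : ℝ) ≤ t := Nat.cast_nonneg t
  have hM0 : (0 : ℝ) ≤ M := Nat.cast_nonneg M
  obtain ⟨X, X', hXX', hXW, hX'W, hX, hX', hXM, hX'M, hXc, hX'c⟩ :=
    h.exists_disjoint_blobs hab ha hb hM hM2 hW (by linarith)
  have hXM' : (M : ℝ) / 2 ≤ X.card := by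
    rw [div_le_iff₀ two_pos, mul_comm]; exact_mod_cast hXM
  have hX'M' : (M : ℝ) / 2 ≤ X'.card := by
    rw [div_le_iff₀ two_pos, mul_comm]; exact_mod_cast hX'M
  have hXc' : (X.card : ℝ) ≤ M + 2 * m + 2 := by exact_mod_cast hXc
  have hX'c' : (X'.card : ℝ) ≤ M + 2 * m + 2 := by exact_mod_cast hX'c
  have hMn : (M : ℝ) / 2 ≤ Fintype.card V / 2 := by
    have : (2 * M : ℝ) ≤ Fintype.card V := by exact_mod_cast hM2
    linarith
  obtain ⟨K, hKd, hK, hKc⟩ := exists_expandsOn h.pos h.le_one h.mul_le_card_nbr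
    (Z := W ∪ (X ∪ X')) (by
      have h1 := Finset.card_union_le W (X ∪ X')
      have h2 := Finset.card_union_le X X'
      have h3 : ((W ∪ (X ∪ X')).card : ℝ) ≤ W.card + X.card + X'.card := by
        exact_mod_cast (by omega : (W ∪ (X ∪ X')).card ≤ W.card + X.card + X'.card)
      linarith)
  rw [Finset.disjoint_union_right, Finset.disjoint_union_right] at hKd
  obtain ⟨hKW, hKX, hKX'⟩ := hKd
  have hexp := h.expandsOn_compl (W := W) (by nlinarith)
  have hXX'ne : (X ∪ X').Nonempty := ⟨a, Finset.mem_union_left _ hX.1⟩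
  have hKne : K.Nonempty := Finset.card_pos.1 (by omega)
  obtain ⟨x, hx, y, hy, T, hTW, L, hL, hp, -, hTX, hTK⟩ := exists_minimal_pathIn
    (hexp.exists_walkIn (by linarith [h.pos]) (A := X ∪ X') (B := K)
      (Finset.subset_compl_iff_disjoint_right.2 (Finset.disjoint_union_left.2 ⟨hXW, hX'W⟩))
      hXX'ne (by exact_mod_cast hXX'ne.card_pos)
      (Finset.subset_compl_iff_disjoint_right.2 hKW)
      hKne (by exact_mod_cast hKne.card_pos) h.lt_pow)
  have hTW' := Finset.subset_compl_iff_disjoint_right.1 hTW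
  rcases Finset.mem_union.1 hx with hxX | hxX'
  · refine h.exists_pathIn_of_blobs hX hX' hXX' hXW hX'W hKW hKX hKX' hK hKc hp hxX hy hTW'
      (fun v hv hvX => hTX v hv (Finset.mem_union_left _ hvX))
      (Finset.disjoint_left.2 fun v hv hvX' => ?_) hTK hL ht (by linarith) hX'M' hMn hMt
    obtain rfl := hTX v hv (Finset.mem_union_right _ hvX')
    exact Finset.disjoint_left.1 hXX' hxX hvX'
  · obtain ⟨q, hq1, hq2, hq⟩ := h.exists_pathIn_of_blobs hX' hX hXX'.symm hX'W hXW hKW hKX' hKX hK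
      hKc hp hxX' hy hTW'
      (fun v hv hvX => hTX v hv (Finset.mem_union_right _ hvX))
      (Finset.disjoint_left.2 fun v hv hvX => by
        obtain rfl := hTX v hv (Finset.mem_union_left _ hvX)
        exact Finset.disjoint_left.1 hXX' hvX hxX') hTK hL ht (by linarith) hXM' hMn hMt
    exact ⟨q, hq1, hq2, hq.symm⟩

end LongPath

section Adjuster

variable [Fintype V] [DecidableEq V] {G : SimpleGraph V}

/-- The vertices at distance exactly `i` from `a` inside `S`. -/
noncomputable def layer (G : SimpleGraph V) (S : Finset V) (a : V) (i : ℕ) : Finset V :=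
  (reach G S {a} i).filter fun v => ∀ j < i, v ∉ reach G S {a} j

theorem mem_layer {S : Finset V} {a v : V} {i : ℕ} :
    v ∈ layer G S a i ↔ WalkIn G S a v i ∧ ∀ j < i, ¬ WalkIn G S a v j := by
  simp [layer, mem_reach]

theorem pathIn_of_mem_layer {S : Finset V} {a v : V} {i : ℕ} (hv : v ∈ layer G S a i) :
    PathIn G S a v i := by
  obtain ⟨hw, hmin⟩ := mem_layer.1 hv
  obtain ⟨K, hK, hp⟩ := hw.exists_pathIn
  rcases hK.lt_or_eq with hlt | rfl
  · exact absurd hp.walkIn (hmin K hlt)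
  · exact hp

theorem WalkIn.exists_mem_layer {S : Finset V} {a v : V} {i : ℕ} (h : WalkIn G S a v i) :
    ∃ j ≤ i, v ∈ layer G S a j := by
  classical
  have hex : ∃ j, WalkIn G S a v j := ⟨i, h⟩
  exact ⟨Nat.find hex, Nat.find_min' hex h, mem_layer.2 ⟨Nat.find_spec hex, fun j hj =>
    Nat.find_min hex hj⟩⟩

theorem mem_layer_of_adj (c : G.Coloring Bool) {S : Finset V} {a u v : V} {i : ℕ}
    (hu : u ∈ layer G S a i) (hv : v ∈ S) (huv : G.Adj u v) :
    v ∈ layer G S a (i + 1) ∨ ∃ j, j + 1 = i ∧ v ∈ layer G S a j := by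
  have hu' := mem_layer.1 hu
  obtain ⟨j, hj, hvj⟩ := (hu'.1.snoc subset_rfl huv hv).exists_mem_layer
  have huS := hu'.1.right_mem
  have hij : i ≤ j + 1 := by
    by_contra! hcon
    exact hu'.2 _ hcon ((mem_layer.1 hvj).1.snoc subset_rfl huv.symm huS)
  have hne : j ≠ i := by
    rintro rfl
    obtain ⟨w, -, hl, -⟩ := pathIn_of_mem_layer hu
    obtain ⟨w', -, hl', -⟩ := pathIn_of_mem_layer hvj
    have h1 := c.even_length_iff_congr w
    have h2 := c.even_length_iff_congr w'
    have h3 := c.valid huv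
    rw [hl] at h1
    rw [hl'] at h2
    revert h1 h2 h3
    cases c a <;> cases c u <;> cases c v <;> simp
  rcases Nat.lt_or_ge i j with hlt | hle
  · obtain rfl : j = i + 1 := by omega
    exact Or.inl hvj
  · exact Or.inr ⟨j, by omega, hvj⟩

variable [DecidableRel G.Adj]

/-- If every vertex of `S` has three neighbours in `S`, then some vertex has two neighbours in the
previous layer, as otherwise the sizes of the layers would at least double. -/
theorem exists_fork (c : G.Coloring Bool) {S : Finset V} {a : V} (ha : a ∈ S)
    (hdeg : ∀ v ∈ S, 3 ≤ (S.filter fun x => G.Adj v x).card) {R : ℕ}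
    (hR : Fintype.card V < 2 ^ R) :
    ∃ i < R, ∃ u ∈ layer G S a (i + 1), ∃ p ∈ layer G S a i, ∃ p' ∈ layer G S a i,
      p ≠ p' ∧ G.Adj p u ∧ G.Adj p' u := by
  classical
  by_contra! hcon
  have huniq : ∀ i < R, ∀ u ∈ layer G S a (i + 1),
      ((layer G S a i).bipartiteBelow G.Adj u).card ≤ 1 := by
    intro i hi u hu
    rw [Finset.card_le_one]
    intro p hp p' hp'
    rw [Finset.mem_bipartiteBelow] at hp hp'
    by_contra hne
    exact hcon i hi u hu p hp.1 p' hp'.1 hne hp.2 hp'.2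
  have key : ∀ i ≤ R, 2 ^ i ≤ (layer G S a i).card := by
    intro i
    induction i with
    | zero =>
      intro _
      rw [pow_zero, Nat.one_le_iff_ne_zero, Finset.card_ne_zero]
      exact ⟨a, mem_layer.2 ⟨.refl ha 0, by simp⟩⟩
    | succ i ih =>
      intro hi
      have h1 := ih (by omega)
      have h2 := Finset.card_mul_le_card_mul G.Adj (s := layer G S a i)
        (t := layer G S a (i + 1)) (m := 2) (n := 1) (fun v hv => ?_)
        (huniq i (by omega))
      · rw [pow_succ]
        omega
      · have hvS := (mem_layer.1 hv).1.right_mem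
        have hsub : (S.filter fun x => G.Adj v x) ⊆
            (layer G S a (i + 1)).bipartiteAbove G.Adj v ∪
              (S.filter fun x => G.Adj v x ∧ ∃ j, j + 1 = i ∧ x ∈ layer G S a j) := by
          intro x hx
          obtain ⟨hxS, hvx⟩ := Finset.mem_filter.1 hx
          rw [Finset.mem_union, Finset.mem_bipartiteAbove, Finset.mem_filter]
          exact (mem_layer_of_adj c hv hxS hvx).imp (fun h => ⟨h, hvx⟩) fun h => ⟨hxS, hvx, h⟩
        have hone : (S.filter fun x => G.Adj v x ∧ ∃ j, j + 1 = i ∧ x ∈ layer G S a j).card ≤ 1 := by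
          rw [Finset.card_le_one]
          intro p hp p' hp'
          obtain ⟨-, hvp, j, hj, hpj⟩ := Finset.mem_filter.1 hp
          obtain ⟨-, hvp', j', hj', hpj'⟩ := Finset.mem_filter.1 hp'
          obtain rfl : j = j' := by omega
          subst hj
          by_contra hne
          exact hcon j (by omega) v hv p hpj p' hpj' hne hvp.symm hvp'.symm
        have h3 := hdeg v hvS
        have h4 := (Finset.card_le_card hsub).trans (Finset.card_union_le _ _)
        omega
  have h1 := key R le_rfl
  have h2 := Finset.card_le_univ (layer G S a R)
  omega

theorem exists_pathIn_add_two (c : G.Coloring Bool) {S : Finset V} {a : V} (ha : a ∈ S)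
    (hdeg : ∀ v ∈ S, 3 ≤ (S.filter fun x => G.Adj v x).card) {R : ℕ}
    (hR : Fintype.card V < 2 ^ R) :
    ∃ p, ∃ T ⊆ S, ∃ i ≤ R, T.card ≤ 2 * R + 2 ∧ PathIn G T a p i ∧ PathIn G T a p (i + 2) := by
  obtain ⟨i, hi, u, hu, p, hp, p', hp', hne, hpu, hp'u⟩ := exists_fork c ha hdeg hR
  have hu' := mem_layer.1 hu
  obtain ⟨T₁, hT₁, hT₁c, hpath₁⟩ := (pathIn_of_mem_layer hp).exists_exact
  have h1 : PathIn G ((reach G S {a} i).erase p) a p' i := by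
    obtain ⟨w, hw, hl, hs⟩ := pathIn_of_mem_layer hp'
    refine ⟨w, hw, hl, fun x hx => ?_⟩
    have hwalk : WalkIn G S a x (w.takeUntil x hx).length :=
      ⟨_, le_rfl, fun y hy => hs y (w.support_takeUntil_subset_support hx hy)⟩
    have hle := w.length_takeUntil_le_length hx
    refine Finset.mem_erase.2 ⟨?_, mem_reach.2 ⟨a, Finset.mem_singleton_self a,
      hwalk.mono subset_rfl (hle.trans hl.le)⟩⟩
    rintro rfl
    have h2 := congrArg SimpleGraph.Walk.length (w.take_spec hx)
    rw [SimpleGraph.Walk.length_append] at h2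
    have h3 : i ≤ (w.takeUntil x hx).length := by
      by_contra! hlt
      exact (mem_layer.1 hp).2 _ hlt hwalk
    exact hne (SimpleGraph.Walk.eq_of_length_eq_zero (p := w.dropUntil x hx) (by omega))
  have h2 : PathIn G {p', u, p} p' p 2 := by
    refine ⟨.cons hp'u (.cons hpu.symm .nil), ?_, rfl, by simp⟩
    simp [hp'u.ne, hne.symm, hpu.ne']
  have h3 := h1.append h2 fun y hy hyT => by
    obtain ⟨hyp, hyr⟩ := Finset.mem_erase.1 hy
    obtain ⟨a', ha', hw⟩ := mem_reach.1 hyr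
    obtain rfl := Finset.mem_singleton.1 ha'
    simp only [Finset.mem_insert, Finset.mem_singleton] at hyT
    rcases hyT with rfl | rfl | rfl
    · rfl
    · exact absurd hw (hu'.2 i (Nat.lt_succ_self i))
    · exact absurd rfl hyp
  obtain ⟨T₂, hT₂, hT₂c, hpath₂⟩ := h3.exists_exact
  refine ⟨p, T₁ ∪ T₂, Finset.union_subset hT₁ (hT₂.trans ?_), i, hi.le, ?_,
    hpath₁.mono Finset.subset_union_left, hpath₂.mono Finset.subset_union_right⟩
  · refine Finset.union_subset ((Finset.erase_subset _ _).trans reach_subset) fun y hy => ?_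
    simp only [Finset.mem_insert, Finset.mem_singleton] at hy
    rcases hy with rfl | rfl | rfl
    · exact (mem_layer.1 hp').1.right_mem
    · exact hu'.1.right_mem
    · exact (mem_layer.1 hp).1.right_mem
  · have := Finset.card_union_le T₁ T₂
    omega

/-- In a bipartite graph of large minimum degree, one can find, avoiding few given vertices,
a small set carrying paths from `a` to a common end vertex of `k + 1` consecutive lengths of
equal parity. -/
theorem exists_adjuster (c : G.Coloring Bool) {W : Finset V} {a : V} (ha : a ∉ W) {R : ℕ}
    (hR : Fintype.card V < 2 ^ R) (k : ℕ)
    (hdeg : ∀ v, W.card + k * (2 * R + 2) + 4 ≤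
      (Finset.univ.filter fun x => G.Adj v x).card) :
    ∃ z A L, A.card ≤ 1 + k * (2 * R + 2) ∧ Disjoint A W ∧ L ≤ k * R ∧
      ∀ i ≤ k, PathIn G A a z (L + 2 * i) := by
  induction k with
  | zero =>
    refine ⟨a, {a}, 0, by simp, by simpa using ha, by simp, fun i hi => ?_⟩
    obtain rfl : i = 0 := by omega
    exact .refl (Finset.mem_singleton_self a)
  | succ k ih =>
    have hmul : (k + 1) * (2 * R + 2) = k * (2 * R + 2) + (2 * R + 2) := by ring
    rw [hmul] at hdeg ⊢
    obtain ⟨z, A, L, hAc, hAW, hL, hp⟩ := ih fun v => by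
      have := hdeg v
      omega
    have hzA := (hp 0 (by omega)).right_mem
    set S := (W ∪ A.erase z)ᶜ with hS
    have hzS : z ∈ S := by simp [hS, Finset.disjoint_left.1 hAW hzA]
    obtain ⟨p, T, hTS, i₀, hi₀, hTc, h1, h2⟩ := exists_pathIn_add_two c hzS (fun v _ => by
      have h1 := hdeg v
      have h2 : (Finset.univ.filter fun x => G.Adj v x) ⊆
          (S.filter fun x => G.Adj v x) ∪ (W ∪ A.erase z) := by
        intro x hx
        by_cases hxS : x ∈ W ∪ A.erase z
        · exact Finset.mem_union_right _ hxS
        · exact Finset.mem_union_left _ (Finset.mem_filter.2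
            ⟨Finset.mem_compl.2 hxS, (Finset.mem_filter.1 hx).2⟩)
      have h3 := (Finset.card_le_card h2).trans (Finset.card_union_le _ _)
      have h4 := Finset.card_union_le W (A.erase z)
      have h5 := Finset.card_erase_le (s := A) (a := z)
      omega) hR
    have hAT : ∀ y ∈ A, y ∈ T → y = z := fun y hyA hyT => by
      have := hTS hyT
      simp only [hS, Finset.mem_compl, Finset.mem_union, Finset.mem_erase] at this
      tauto
    refine ⟨p, A ∪ T, L + i₀, ?_, ?_, ?_, fun i hi => ?_⟩
    · have := Finset.card_union_le A T
      omega
    · refine Finset.disjoint_union_left.2 ⟨hAW, Finset.disjoint_left.2 fun x hxT hxW => ?_⟩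
      have := hTS hxT
      simp [hS, hxW] at this
    · rw [Nat.succ_mul]
      omega
    · rcases Nat.lt_or_ge k i with hlt | hle
      · have := (hp k le_rfl).append h2 hAT
        rwa [show L + 2 * k + (i₀ + 2) = L + i₀ + 2 * i by omega] at this
      · have := (hp i hle).append h1 hAT
        rwa [show L + 2 * i + i₀ = L + i₀ + 2 * i by omega] at this

/-- Two vertices of a robust bipartite expander are joined by a path of any prescribed length
of the correct parity. -/
theorem IsRobust.exists_pathIn_length [Nonempty V] {ε κ : ℝ} {m : ℕ} (h : IsRobust G ε κ m)
    (c : G.Coloring Bool) {U : Finset V} {a b : V} (hab : a ≠ b) (ha : a ∉ U) (hb : b ∉ U)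
    {R M ℓ B : ℕ} (hR : Fintype.card V < 2 ^ R) (hB : 5 * m * (2 * R + 2) + U.card + 1 ≤ B)
    (hdeg : ∀ v, B + 4 ≤ (Finset.univ.filter fun x => G.Adj v x).card)
    (hM : 4 * (m + 1) * (2 * m + 1) < M) (hM2 : 2 * M ≤ Fintype.card V)
    (hW : 2 * ((B : ℝ) + (2 * m + 1) + 4 * (m + 1) * (2 * m + 1)) ≤ κ)
    (hℓ : 5 * m * R + 16 * m ≤ ℓ)
    (hMW : 16 * ((B : ℝ) + 2 * (M + 2 * m + 2) + ℓ + 1) ≤ ε ^ 2 * Fintype.card V)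
    (hMt : 2 * ((B : ℝ) + ℓ + 2 * m) ≤ ε * (M / 2))
    (hpar : Even ℓ ↔ (c a ↔ c b)) :
    PathIn G Uᶜ a b ℓ := by
  obtain ⟨z, A, L, hAc, hAW, hL, hp⟩ := exists_adjuster c (W := insert b U) (a := a)
    (by simp [hab, ha]) hR (5 * m) fun v => by
      have := Finset.card_insert_le b U
      have := hdeg v
      omega
  rw [Finset.disjoint_insert_right] at hAW
  obtain ⟨hbA, hAU⟩ := hAW
  have hzA := (hp 0 (by omega)).right_mem
  set W := U ∪ A.erase z with hWdef
  have hWc : W.card ≤ B := by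
    have h1 : W.card ≤ _ := Finset.card_union_le U (A.erase z)
    have h2 := Finset.card_erase_of_mem hzA
    omega
  have hWc' : (W.card : ℝ) ≤ B := by exact_mod_cast hWc
  have htℓ : ((ℓ - L - 10 * m : ℕ) : ℝ) ≤ ℓ := by exact_mod_cast (by omega)
  obtain ⟨q, hq1, hq2, hq⟩ := h.exists_long_pathIn (W := W) (a := z) (b := b)
    (t := ℓ - L - 10 * m) (fun hzb => hbA (hzb ▸ hzA))
    (by simp [hWdef, Finset.disjoint_left.1 hAU hzA]) (by simp [hWdef, hb, hbA]) hM hM2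
    (by linarith) (by omega) (by linarith) (by linarith)
  have hdisj : ∀ y ∈ A, y ∈ Wᶜ → y = z := fun y hyA hyW => by
    simp only [hWdef, Finset.mem_compl, Finset.mem_union, Finset.mem_erase] at hyW
    tauto
  have hsub : A ∪ Wᶜ ⊆ Uᶜ := by
    intro x hx
    rcases Finset.mem_union.1 hx with hx | hx
    · exact Finset.mem_compl.2 (Finset.disjoint_left.1 hAU hx)
    · simp only [hWdef, Finset.mem_compl, Finset.mem_union, not_or] at hx
      exact Finset.mem_compl.2 hx.1
  have hparity : Even (L + q) ↔ Even ℓ := by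
    obtain ⟨w, -, hl, -⟩ := (hp 0 (by omega)).append hq hdisj
    rw [hpar, ← c.even_length_iff_congr w, hl, mul_zero, add_zero]
  rw [Nat.even_iff, Nat.even_iff] at hparity
  have hfin := ((hp ((ℓ - L - q) / 2) (by omega)).append hq hdisj).mono hsub
  rwa [show L + 2 * ((ℓ - L - q) / 2) + q = ℓ by omega] at hfin

end Adjuster

section Numerics

theorem lt_one_add_pow {n : ℕ} (hn : 1 ≤ Real.log n) {m : ℕ} (hm : 16 * Real.log n ^ 3 < m) :
    (n : ℝ) < (1 + 1 / (2 * Real.log n ^ 2) / 4) ^ m := by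
  set x := Real.log n with hx
  have hnpos : (0 : ℝ) < n := by
    rcases Nat.eq_zero_or_pos n with rfl | h
    · simp [hx] at hn
      linarith
    · exact_mod_cast h
  have hη : 0 < 1 + 1 / (2 * x ^ 2) / 4 := by positivity
  rw [← Real.log_lt_log_iff hnpos (pow_pos hη m), Real.log_pow, ← hx]
  have h1 := Real.one_sub_inv_le_log_of_pos hη
  have h2 : 1 / (16 * x ^ 2) ≤ 1 - (1 + 1 / (2 * x ^ 2) / 4)⁻¹ := by
    rw [show 1 - (1 + 1 / (2 * x ^ 2) / 4)⁻¹ = 1 / (8 * x ^ 2 + 1) by field_simp; ring]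
    exact one_div_le_one_div_of_le (by positivity) (by nlinarith)
  calc x = 16 * x ^ 3 * (1 / (16 * x ^ 2)) := by field_simp
    _ < m * (1 / (16 * x ^ 2)) := by gcongr
    _ ≤ m * Real.log (1 + 1 / (2 * x ^ 2) / 4) := by
      gcongr
      exact h2.trans h1

theorem lt_two_pow_of_log {n R : ℕ} (hn : 0 < n) (hR : 2 * Real.log n < R) : n < 2 ^ R := by
  have h : (n : ℝ) < 2 ^ R := by
    rw [← Real.log_lt_log_iff (by exact_mod_cast hn) (by positivity), Real.log_pow]
    nlinarith [Real.log_two_gt_d9, (Nat.cast_nonneg R : (0 : ℝ) ≤ R)]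
  exact_mod_cast h

theorem thousand_mul_pow_le {x : ℝ} (hx : 1000 ≤ x) {E : ℝ} (hE : 0 ≤ E) (k : ℕ) :
    1000 * (E * x ^ k) ≤ E * x ^ (k + 1) := by
  rw [pow_succ', mul_left_comm]
  gcongr

theorem four_mul_succ_mul_le {x m : ℝ} (hx : 1000 ≤ x) (hm0 : 0 ≤ m) (hm : m ≤ 17 * x ^ 3) :
    4 * (m + 1) * (2 * m + 1) ≤ 3000 * x ^ 6 := by
  have h1 : 1 ≤ x ^ 3 := one_le_pow₀ (by linarith)
  calc 4 * (m + 1) * (2 * m + 1) ≤ 4 * (18 * x ^ 3) * (35 * x ^ 3) := by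
        gcongr <;> linarith
    _ = 2520 * x ^ 6 := by ring
    _ ≤ 3000 * x ^ 6 := by gcongr; norm_num

theorem pow_eight_le_expansion {x ε₂ D : ℝ} (hx : 0 < x) (hD : 0 ≤ D) (h : 1 ≤ ε₂ * x) :
    D * x ^ 8 / 4 ≤ ε₂ * (D * x ^ 11) / (4 * x ^ 2) := by
  calc D * x ^ 8 / 4 ≤ D * x ^ 8 / 4 * (ε₂ * x) := le_mul_of_one_le_right (by positivity) h
    _ = ε₂ * (D * x ^ 11) / (4 * x ^ 2) := by field_simp

end Numerics

section Expander

variable [Fintype V] {G : SimpleGraph V}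

theorem coe_nbr (X : Finset V) : (nbr G X : Set V) = extNbr G X := by
  ext v
  simp [mem_nbr, extNbr]

theorem IsExpander.isRobust {ε₂ d : ℝ} (hG : IsExpander G (1 / 2) (ε₂ * d))
    (hδ : MinDegGE G d) (hε₂ : 0 < ε₂) (hε₂1 : ε₂ < 1) (hk : 15 / 2 ≤ ε₂ * d)
    (hlog : 1 ≤ Real.log (Fintype.card V)) {m : ℕ}
    (hm : 16 * Real.log (Fintype.card V) ^ 3 < m) :
    IsRobust G (1 / (2 * Real.log (Fintype.card V) ^ 2))
      (ε₂ * d / (4 * Real.log (Fintype.card V) ^ 2)) m := by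
  classical
  have hpow := lt_one_add_pow hlog hm
  set x := Real.log (Fintype.card V) with hx
  have hd : 0 < d := by
    by_contra! hcon
    nlinarith
  have hε : 1 / (2 * x ^ 2) ≤ 1 / 2 := one_div_le_one_div_of_le two_pos (by nlinarith)
  have hε0 : 0 < 1 / (2 * x ^ 2) := by positivity
  have hκ : ε₂ * d / (4 * x ^ 2) = 1 / (2 * x ^ 2) * (ε₂ * d / 2) := by
    field_simp
    norm_num
  have hsmall : ∀ X : Finset V, X.Nonempty → (X.card : ℝ) < ε₂ * d / 2 →
      d / 2 ≤ (nbr G X).card := by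
    rintro X ⟨v, hv⟩ hX
    have h1 : G.neighborSet v ⊆ ((nbr G X ∪ X : Finset V) : Set V) := by
      intro u hu
      by_cases huX : u ∈ X
      · simp [huX]
      · have : u ∈ nbr G X := mem_nbr.2 ⟨huX, v, hv, hu⟩
        simp [this]
    have h2 := Set.ncard_le_ncard h1 (Finset.finite_toSet _)
    rw [Set.ncard_coe_finset] at h2
    have h3 : ((G.neighborSet v).ncard : ℝ) ≤ (nbr G X).card + X.card := by
      exact_mod_cast h2.trans (Finset.card_union_le _ _)
    have h4 := hδ v
    nlinarith
  have hlarge : ∀ X : Finset V, 2 * X.card ≤ Fintype.card V → ε₂ * d / 2 ≤ X.card →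
      1 / (2 * x ^ 2) * X.card ≤ (nbr G X).card := by
    intro X hX2 hX
    have hX2' : (2 * X.card : ℝ) ≤ Fintype.card V := by exact_mod_cast hX2
    have h1 := hG X (by rwa [Set.ncard_coe_finset])
      (by rw [Set.ncard_coe_finset, Nat.card_eq_fintype_card]; linarith)
    rw [← coe_nbr, Set.ncard_coe_finset, Set.ncard_coe_finset, epsFn,
      if_neg (by linarith)] at h1
    refine le_trans (mul_le_mul_of_nonneg_right ?_ (Nat.cast_nonneg _)) h1
    have hkpos : 0 < ε₂ * d := by linarith
    have h2 : 1 < 15 * (X.card : ℝ) / (ε₂ * d) := by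
      rw [lt_div_iff₀ hkpos]
      linarith
    have h3 : 15 * (X.card : ℝ) / (ε₂ * d) ≤ Fintype.card V := by
      rw [div_le_iff₀ hkpos]
      nlinarith [(Nat.cast_nonneg (Fintype.card V) : (0 : ℝ) ≤ Fintype.card V)]
    have h4 := Real.log_pos h2
    have h5 : Real.log (15 * (X.card : ℝ) / (ε₂ * d)) ≤ x :=
      Real.log_le_log (by linarith) h3
    rw [show (1 : ℝ) / (2 * x ^ 2) = 1 / 2 / x ^ 2 by rw [div_div]]
    gcongr
  refine ⟨hε0, by linarith, fun X hne hX2 => ?_, fun X hne hX2 => ?_, hpow⟩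
  · rcases lt_or_ge (X.card : ℝ) (ε₂ * d / 2) with hlt | hge
    · have := hsmall X hne hlt
      nlinarith [(Nat.cast_nonneg X.card : (0 : ℝ) ≤ X.card)]
    · exact hlarge X hX2 hge
  · rw [hκ]
    rcases lt_or_ge (X.card : ℝ) (ε₂ * d / 2) with hlt | hge
    · have := hsmall X hne hlt
      have : ε₂ * d ≤ d := by nlinarith
      nlinarith
    · exact (mul_le_mul_of_nonneg_left hge hε0.le).trans (hlarge X hX2 hge)

theorem IsRobust.even_iff_of_piVal {ε κ : ℝ} {m : ℕ} (h : IsRobust G ε κ m) (hκ : 0 ≤ κ)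
    (c : G.Coloring Bool) {a b : V} (hab : a ≠ b) {ℓ : ℕ} (hℓ : ℓ % 2 = piVal G a b % 2) :
    Even ℓ ↔ (c a ↔ c b) := by
  classical
  rw [piVal, if_neg hab] at hℓ
  split_ifs at hℓ with hw
  · obtain ⟨w, hw⟩ := hw
    rw [← c.even_length_iff_congr w, Nat.even_iff, hℓ]
    simpa using hw
  · have hexp := h.expandsOn_compl (W := ∅) (by simpa using hκ)
    obtain ⟨a', ha, b', hb, w, -, -⟩ := hexp.exists_walkIn (by linarith [h.pos]) (A := {a})
      (B := {b}) (by simp) (by simp) (by simp) (by simp) (by simp) (by simp) h.lt_pow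
    obtain rfl := Finset.mem_singleton.1 ha
    obtain rfl := Finset.mem_singleton.1 hb
    rw [← c.even_length_iff_congr w, Nat.even_iff, hℓ]
    simpa using fun hodd => hw ⟨w, hodd⟩

/-- In a bipartite expander of large minimum degree, any two vertices are joined by a path of any
prescribed length of the correct parity avoiding few given vertices. -/
theorem IsExpander.exists_pathIn_length [DecidableEq V] {ε₂ d : ℝ}
    (hG : IsExpander G (1 / 2) (ε₂ * d)) (hδ : MinDegGE G d) (c : G.Coloring Bool)
    (hε₂ : 0 < ε₂) (hε₂1 : ε₂ < 1) (hk : 15 / 2 ≤ ε₂ * d)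
    {x : ℝ} (hx : Real.log (Fintype.card V) = x) (hx1 : 1000 ≤ x) (hε₂x : 1 ≤ ε₂ * x)
    (hxd : x ^ 20 ≤ d) (hdn : d ≤ Fintype.card V) {U : Finset V}
    (hU : (U.card : ℝ) ≤ d / x ^ 10 / (2 * x ^ 3)) {a b : V} (hab : a ≠ b) (ha : a ∉ U)
    (hb : b ∉ U) {ℓ : ℕ} (hℓ : x ^ 7 ≤ ℓ) (hℓn : ℓ ≤ Fintype.card V / x ^ 10)
    (hpar : ℓ % 2 = piVal G a b % 2) :
    PathIn G Uᶜ a b ℓ := by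
  classical
  have : Nonempty V := ⟨a⟩
  obtain ⟨m, hm⟩ : ∃ m, ⌊16 * x ^ 3⌋₊ + 1 = m := ⟨_, rfl⟩
  obtain ⟨R, hR⟩ : ∃ R, ⌊2 * x⌋₊ + 1 = R := ⟨_, rfl⟩
  set N : ℝ := (Fintype.card V : ℝ) with hN
  obtain ⟨M, hM⟩ : ∃ M, ⌈N / x ^ 6⌉₊ = M := ⟨_, rfl⟩
  obtain ⟨B, hB⟩ : ∃ B, 5 * m * (2 * R + 2) + U.card + 1 = B := ⟨_, rfl⟩
  have hx0 : 0 < x := by linarith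
  have hN0 : 0 ≤ N := Nat.cast_nonneg _
  have p0 : 1 ≤ x ^ 3 := one_le_pow₀ (by linarith)
  have p1 : 1 ≤ x := by linarith
  have hm1 : 16 * x ^ 3 < m := by
    rw [← hm]
    push_cast
    exact Nat.lt_floor_add_one _
  have hm2 : (m : ℝ) ≤ 17 * x ^ 3 := by
    have := Nat.floor_le (show 0 ≤ 16 * x ^ 3 by positivity)
    rw [← hm]
    push_cast
    linarith
  have hR1 : 2 * x < R := by
    rw [← hR]
    push_cast
    exact Nat.lt_floor_add_one _
  have hR2 : (R : ℝ) ≤ 3 * x := by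
    have := Nat.floor_le (show 0 ≤ 2 * x by positivity)
    rw [← hR]
    push_cast
    linarith
  have hrob := hG.isRobust hδ hε₂ hε₂1 hk (by linarith) (m := m) (by rwa [hx])
  rw [hx] at hrob
  have hM1 : N / x ^ 6 ≤ M := hM ▸ Nat.le_ceil _
  have hM2 : (M : ℝ) ≤ N / x ^ 6 + 1 := hM ▸ (Nat.ceil_lt_add_one (by positivity)).le
  obtain ⟨D, hD⟩ : ∃ D, d / x ^ 11 = D := ⟨_, rfl⟩
  obtain ⟨E, hE⟩ : ∃ E, N / x ^ 10 = E := ⟨_, rfl⟩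
  have hD' : d = D * x ^ 11 := by rw [← hD]; field_simp
  have hE' : N = E * x ^ 10 := by rw [← hE]; field_simp
  have hD9 : x ^ 9 ≤ D := by
    rw [← hD, le_div_iff₀ (by positivity), ← pow_add]
    exact hxd
  have hE10 : x ^ 10 ≤ E := by
    rw [← hE, le_div_iff₀ (by positivity), ← pow_add]
    exact hxd.trans hdn
  have hDE : D ≤ E := by
    rw [← hD, ← hE]
    have : (0 : ℝ) ≤ d := (by positivity : (0 : ℝ) ≤ x ^ 20).trans hxd
    gcongr
    norm_num
  have hNM : N / x ^ 6 = E * x ^ 4 := by rw [hE']; field_simp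
  rw [hNM] at hM1 hM2
  rw [hE] at hℓn
  have hD0 : 0 < D := lt_of_lt_of_le (by positivity) hD9
  have hE0 : 0 < E := lt_of_lt_of_le (by positivity) hE10
  have hU' : (U.card : ℝ) ≤ D / 2 := by
    refine hU.trans ?_
    rw [hD', div_div, div_le_div_iff₀ (by positivity) two_pos]
    have : D * x ^ 11 ≤ D * x ^ 13 := by gcongr; norm_num
    linarith [show D * (x ^ 10 * (2 * x ^ 3)) = 2 * (D * x ^ 13) by ring]
  have hpow (k : ℕ) : 1000 * x ^ k ≤ x ^ (k + 1) := by
    simpa using thousand_mul_pow_le hx1 zero_le_one k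
  have p3 : 1000 * x ^ 3 ≤ x ^ 4 := hpow 3
  have p4 : 1000 * x ^ 4 ≤ x ^ 5 := hpow 4
  have p5 : 1000 * x ^ 5 ≤ x ^ 6 := hpow 5
  have p6 : 1000 * x ^ 6 ≤ x ^ 7 := hpow 6
  have p7 : 1000 * x ^ 7 ≤ x ^ 8 := hpow 7
  have p8 : 1000 * x ^ 8 ≤ x ^ 9 := hpow 8
  have p9 : 1000 * x ^ 9 ≤ x ^ 10 := hpow 9
  have hEx := thousand_mul_pow_le hx1 hE0.le
  have hm0 : (0 : ℝ) ≤ m := Nat.cast_nonneg m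
  have hmR : (m : ℝ) * R ≤ 51 * x ^ 4 := by
    calc (m : ℝ) * R ≤ (17 * x ^ 3) * (3 * x) := by gcongr
      _ = 51 * x ^ 4 := by ring
  have hBD : (B : ℝ) ≤ D := by
    have h : (B : ℝ) = 10 * (m * R) + 10 * m + U.card + 1 := by
      rw [← hB]
      push_cast
      ring
    linarith
  have hmm := four_mul_succ_mul_le hx1 hm0 hm2
  have e0 : 1000 * E ≤ E * x := by simpa using hEx 0
  have e1 : 1000 * (E * x) ≤ E * x ^ 2 := by simpa using hEx 1
  have e2 : 1000 * (E * x ^ 2) ≤ E * x ^ 3 := hEx 2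
  have e3 : 1000 * (E * x ^ 3) ≤ E * x ^ 4 := hEx 3
  have e4 : 1000 * (E * x ^ 4) ≤ E * x ^ 5 := hEx 4
  have e5 : 1000 * (E * x ^ 5) ≤ E * x ^ 6 := hEx 5
  have e6 : E * x ^ 6 ≤ E * x ^ 10 := by gcongr; norm_num
  refine hrob.exists_pathIn_length c hab ha hb (R := R) (M := M) (B := B)
    (lt_two_pow_of_log Fintype.card_pos (by rwa [hx])) hB.le (fun v => ?_) ?_ ?_ ?_ ?_ ?_ ?_
    (hrob.even_iff_of_piVal (by positivity) c hab hpar)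
  · have h1 := hδ v
    have h2 : G.neighborSet v = ((Finset.univ.filter fun x => G.Adj v x : Finset V) : Set V) := by
      ext u
      simp
    rw [h2, Set.ncard_coe_finset] at h1
    have h3 : (B : ℝ) + 4 ≤ d := by
      have : 1000 * (D * x ^ 10) ≤ d := hD' ▸ thousand_mul_pow_le hx1 hD0.le 10
      have : D ≤ D * x ^ 10 := le_mul_of_one_le_right hD0.le (one_le_pow₀ (by linarith))
      linarith
    exact_mod_cast h3.trans h1
  · have : 4 * ((m : ℝ) + 1) * (2 * m + 1) < M := by linarith
    exact_mod_cast this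
  · have : 2 * (M : ℝ) ≤ N := by linarith
    rw [hN] at this
    exact_mod_cast this
  · have hκ := hD' ▸ pow_eight_le_expansion hx0 hD0.le hε₂x
    have : D * 1000 ≤ D * x ^ 8 := by
      gcongr
      exact hx1.trans (le_self_pow₀ (by linarith) (by norm_num))
    linarith
  · have : 5 * (m : ℝ) * R + 16 * m ≤ ℓ := by linarith
    exact_mod_cast this
  · have hε2 : (1 / (2 * x ^ 2)) ^ 2 * N = E * x ^ 6 / 4 := by
      rw [hE']
      field_simp
      norm_num
    rw [hε2]
    linarith
  · have hεM : E * x ^ 2 / 4 ≤ 1 / (2 * x ^ 2) * (M / 2) := by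
      calc E * x ^ 2 / 4 = 1 / (2 * x ^ 2) * (E * x ^ 4 / 2) := by
            field_simp
            norm_num
        _ ≤ 1 / (2 * x ^ 2) * (M / 2) := by gcongr
    linarith

end Expander

/-- connecting two expansions by a path of any plausible length
in a dense expander (Lemma 3.5). -/
theorem statement5 :
    ∃ ε₁ : ℝ, 0 < ε₁ ∧ ε₁ < 1 ∧
      ∀ ε₂ : ℝ, 0 < ε₂ → ε₂ < 1 → ∀ s : ℝ, 20 ≤ s →
        ∃ d₀ : ℝ, ∀ (n : ℕ) (d : ℝ), d₀ ≤ d → d ≤ n → Real.log n ^ s ≤ d →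
          ∀ (V : Type) [Fintype V] (G : SimpleGraph V), Nat.card V = n →
            IsBip G → IsExpander G ε₁ (ε₂ * d) → MinDegGE G d →
              ∀ U : Set V, (U.ncard : ℝ) ≤ (d / Real.log n ^ 10) / (2 * Real.log n ^ 3) →
                ∀ (v₁ v₂ : V) (F₁ F₂ : G.Subgraph),
                  Disjoint F₁.verts U → Disjoint F₂.verts U →
                  Disjoint F₁.verts F₂.verts →
                  IsExpansion G F₁ v₁ (d / Real.log n ^ 10) (800 / ε₁ * Real.log n ^ 3) →
                  IsExpansion G F₂ v₂ (d / Real.log n ^ 10) (800 / ε₁ * Real.log n ^ 3) →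
                  ∀ ℓ : ℕ, Real.log n ^ 7 ≤ (ℓ : ℝ) → (ℓ : ℝ) ≤ n / Real.log n ^ 10 →
                    ℓ % 2 = piVal G v₁ v₂ % 2 →
                    ∃ w : G.Walk v₁ v₂, w.IsPath ∧ w.length = ℓ ∧
                      ∀ x ∈ w.support, x ∉ U := by
  refine ⟨1 / 2, by norm_num, by norm_num, fun ε₂ hε₂ hε₂1 s hs =>
    ⟨Real.exp 1000 + Real.exp (1 / ε₂) + 15 / 2 / ε₂, ?_⟩⟩
  intro n d hd₀ hdn hds V _ G hn ⟨f, hf⟩ hG hδ U hU v₁ v₂ F₁ F₂ hF₁ hF₂ hF hv₁ hv₂ ℓ hℓ hℓn hpar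
  classical
  obtain ⟨hv₁, -⟩ := hv₁
  obtain ⟨hv₂, -⟩ := hv₂
  rw [Nat.card_eq_fintype_card] at hn
  subst hn
  have h₁ := Real.exp_pos 1000
  have h₂ := Real.exp_pos (1 / ε₂)
  have h₃ : 0 < 15 / 2 / ε₂ := by positivity
  have hpos : (0 : ℝ) < Fintype.card V := by linarith
  have hx : 1000 ≤ Real.log (Fintype.card V) :=
    (Real.le_log_iff_exp_le hpos).2 (by linarith)
  have hεx : 1 / ε₂ ≤ Real.log (Fintype.card V) :=
    (Real.le_log_iff_exp_le hpos).2 (by linarith)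
  have hk : 15 / 2 / ε₂ ≤ d := by linarith
  rw [div_le_iff₀' hε₂] at hεx hk
  have hxd : Real.log (Fintype.card V) ^ 20 ≤ d := by
    refine le_trans ?_ hds
    rw [← Real.rpow_natCast]
    exact Real.rpow_le_rpow_of_exponent_le (by linarith) (by exact_mod_cast hs)
  obtain ⟨w, hw, hwℓ, hwU⟩ := hG.exists_pathIn_length hδ
    (SimpleGraph.Coloring.mk f fun h => hf _ _ h) hε₂ hε₂1 hk rfl hx hεx hxd hdn
    (U := U.toFinset) (by rwa [← Set.ncard_eq_toFinset_card'])
    (hF.ne_of_mem hv₁ hv₂)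
    (by simpa using Set.disjoint_left.1 hF₁ hv₁) (by simpa using Set.disjoint_left.1 hF₂ hv₂)
    hℓ hℓn hpar
  exact ⟨w, hw, hwℓ, fun x hx => by simpa using hwU x hx⟩

end Balanced
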